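/- Let n ∈ ℕ, s ∈ (1, n+1)\ℕ and let A be a Young function. Then V^{s,A}_{d,1}(ℝⁿ) → VMO(ℝⁿ) uniformly if and only if either (a) s < n, there exists c > 0 such that ∫_0^t Ã(τ) τ^{−1−n/(n+1−s)} dτ ≤ c t^{n/((n−s)(n+1−s))} for all t > 0, and lim_{t→∞} t^{−n/((n−s)(n+1−s))} ∫_0^t Ã(τ) τ^{−1−n/(n+1−s)} dτ = 0, or (b) s = n and there exist c > 0, t₀ > 0 such that A(t) ≥ c t for all t ∈ [0,t₀]. -/

import Mathlib

open MeasureTheory Metric Set Filter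
open scoped ENNReal Topology

noncomputable section

/-- Euclidean space `ℝⁿ`. -/
abbrev Euc (n : ℕ) := EuclideanSpace ℝ (Fin n)

/-- A Young function: convex, left-continuous, vanishing at `0`,
non-constant on `(0,∞)`, with values in `[0,∞]`. -/
def IsYoung (A : ℝ → ℝ≥0∞) : Prop :=
  A 0 = 0 ∧
  (∀ x y t : ℝ, 0 ≤ x → 0 ≤ y → 0 ≤ t → t ≤ 1 →
      A (t * x + (1 - t) * y) ≤ ENNReal.ofReal t * A x + ENNReal.ofReal (1 - t) * A y) ∧
  (∀ t : ℝ, 0 < t → ContinuousWithinAt A (Set.Iic t) t) ∧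
  (∃ t₁ t₂ : ℝ, 0 < t₁ ∧ 0 < t₂ ∧ A t₁ ≠ A t₂)

/-- The right-continuous generalized inverse of a monotone function `A : [0,∞) → [0,∞]`. -/
def rcInv (A : ℝ → ℝ≥0∞) (v : ℝ≥0∞) : ℝ :=
  sInf {τ : ℝ | 0 ≤ τ ∧ v < A τ}

/-- The Young conjugate `Ã(t) = sup {τ t - A(τ) : τ ≥ 0}`. -/
def youngConj (A : ℝ → ℝ≥0∞) (t : ℝ) : ℝ≥0∞ :=
  ⨆ (τ : ℝ) (_ : 0 ≤ τ), ENNReal.ofReal (τ * t) - A τ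

/-- The functional `J_{σ,A}(v)` for a vector-valued `v`, with the Euclidean norm. -/
def Jfun (n : ℕ) (σ : ℝ) (A : ℝ → ℝ≥0∞) {ι : Type} [Fintype ι]
    (v : Euc n → ι → ℝ) : ℝ≥0∞ :=
  ∫⁻ x : Euc n, ∫⁻ y : Euc n,
    A (Real.sqrt (∑ i, (v x i - v y i) ^ 2) / ‖x - y‖ ^ σ) /
      ENNReal.ofReal (‖x - y‖ ^ (n : ℝ))

/-- The fractional Orlicz–Sobolev seminorm `|v|_{σ,A,ℝⁿ}` (vector-valued version). -/
def fracSem (n : ℕ) (σ : ℝ) (A : ℝ → ℝ≥0∞) {ι : Type} [Fintype ι]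
    (v : Euc n → ι → ℝ) : ℝ≥0∞ :=
  sInf (ENNReal.ofReal '' {lam : ℝ | 0 < lam ∧ Jfun n σ A (fun x i => v x i / lam) ≤ 1})

/-- The fractional Orlicz–Sobolev seminorm `|u|_{σ,A,ℝⁿ}` of a scalar function. -/
def fracSemS (n : ℕ) (σ : ℝ) (A : ℝ → ℝ≥0∞) (u : Euc n → ℝ) : ℝ≥0∞ :=
  fracSem n σ A (fun x (_ : Fin 1) => u x)

/-- The normalized mean oscillation `φ(|B|^{1/n})⁻¹ ⨍_B |u - u_B|` over the ball `B = B(x,r)`. -/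
def oscQuot (n : ℕ) (φ : ℝ → ℝ) (u : Euc n → ℝ) (x : Euc n) (r : ℝ) : ℝ :=
  (φ ((volume (ball x r)).toReal ^ ((n : ℝ)⁻¹)))⁻¹ *
    ⨍ y in ball x r, |u y - ⨍ z in ball x r, u z|

/-- The Campanato seminorm `|u|_{𝓛^φ(ℝⁿ)}`. -/
def campSem (n : ℕ) (φ : ℝ → ℝ) (u : Euc n → ℝ) : ℝ≥0∞ :=
  ⨆ (x : Euc n) (r : ℝ) (_ : 0 < r), ENNReal.ofReal (oscQuot n φ u x r)

/-- The Campanato quantity restricted to balls of measure at most `r`. -/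
def campSemSmall (n : ℕ) (φ : ℝ → ℝ) (u : Euc n → ℝ) (r : ℝ) : ℝ≥0∞ :=
  ⨆ (x : Euc n) (ρ : ℝ) (_ : 0 < ρ) (_ : volume (ball x ρ) ≤ ENNReal.ofReal r),
    ENNReal.ofReal (oscQuot n φ u x ρ)

/-- `φ : (0,∞) → (0,∞)` is admissible: positive and bounded below away from zero on `[a,∞)`. -/
def Admissible (φ : ℝ → ℝ) : Prop :=
  (∀ r : ℝ, 0 < r → 0 < φ r) ∧
  ∀ a : ℝ, 0 < a → ∃ ε : ℝ, 0 < ε ∧ ∀ r : ℝ, a ≤ r → ε ≤ φ r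

/-- `φ_{s,A}(r) = r^s A⁻¹(r^{-n})`. -/
def phiSA (n : ℕ) (s : ℝ) (A : ℝ → ℝ≥0∞) (r : ℝ) : ℝ :=
  r ^ s * rcInv A (ENNReal.ofReal (r ^ (-(n : ℝ))))

/-- `u` is `m`-times weakly differentiable, with iterated weak partial
derivatives recorded by `D`. -/
def HasWeakDerivs (n m : ℕ) (u : Euc n → ℝ)
    (D : (h : ℕ) → Euc n → (Fin h → Fin n) → ℝ) : Prop :=
  (∀ x d, D 0 x d = u x) ∧
  ∀ h : ℕ, h ≤ m → ∀ dirs : Fin h → Fin n,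
    LocallyIntegrable (fun x => D h x dirs) volume ∧
    ∀ φ : Euc n → ℝ, ContDiff ℝ (⊤ : ℕ∞) φ → HasCompactSupport φ →
      ∫ x : Euc n, u x *
          iteratedFDeriv ℝ h φ x (fun i => EuclideanSpace.single (dirs i) (1 : ℝ)) =
        (-1 : ℝ) ^ h * ∫ x : Euc n, D h x dirs * φ x

/-- The Euclidean length `|∇^h u|(x)` of the `h`-th order weak gradient. -/
def gradLen (n : ℕ) (D : (h : ℕ) → Euc n → (Fin h → Fin n) → ℝ) (h : ℕ) (x : Euc n) : ℝ :=
  Real.sqrt (∑ d : Fin h → Fin n, (D h x d) ^ 2)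

/-- The derivatives of orders `k, …, m` decay near infinity:
`|{|∇^h u| > t}| < ∞` for every `t > 0`. -/
def DecayFrom (n k m : ℕ) (D : (h : ℕ) → Euc n → (Fin h → Fin n) → ℝ) : Prop :=
  ∀ h : ℕ, k ≤ h → h ≤ m → ∀ t : ℝ, 0 < t →
    volume {x : Euc n | t < gradLen n D h x} < ⊤

/-- The Young function `F_k(t) = t^{n/(n-s+k+1)} ∫_0^t Ã(τ) τ^{-1-n/(n-s+k+1)} dτ`. -/
def Fk (n : ℕ) (s : ℝ) (k : ℕ) (A : ℝ → ℝ≥0∞) (t : ℝ) : ℝ≥0∞ :=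
  ENNReal.ofReal (t ^ ((n : ℝ) / ((n : ℝ) - s + (k : ℝ) + 1))) *
    ∫⁻ τ in Set.Ioc (0 : ℝ) t,
      youngConj A τ * ENNReal.ofReal (τ ^ (-1 - (n : ℝ) / ((n : ℝ) - s + (k : ℝ) + 1)))

/-- `ψ^k_{s,A}(r) = 1 / (r^{n-s+k} F_k⁻¹(r^{-n}))`. -/
def psiK (n : ℕ) (s : ℝ) (k : ℕ) (A : ℝ → ℝ≥0∞) (r : ℝ) : ℝ :=
  (r ^ ((n : ℝ) - s + (k : ℝ)) * rcInv (Fk n s k A) (ENNReal.ofReal (r ^ (-(n : ℝ)))))⁻¹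

/-- `ψ^{[s]}_{s,A}(r) = r^{{s}} A⁻¹(r^{-n})`. -/
def psiTop (n : ℕ) (s : ℝ) (A : ℝ → ℝ≥0∞) (r : ℝ) : ℝ :=
  r ^ (s - (⌊s⌋₊ : ℝ)) * rcInv A (ENNReal.ofReal (r ^ (-(n : ℝ))))

/-- Convergence near zero of `∫_0 (t/A(t))^{(s-(k+1))/(n-(s-(k+1)))} dt`. -/
def IntCondK (n : ℕ) (s : ℝ) (k : ℕ) (A : ℝ → ℝ≥0∞) : Prop :=
  ∃ ε : ℝ, 0 < ε ∧
    ∫⁻ t in Set.Ioc (0 : ℝ) ε,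
      (ENNReal.ofReal t / A t) ^ ((s - (k : ℝ) - 1) / ((n : ℝ) - (s - (k : ℝ) - 1))) < ⊤

/-- `P` is the projection polynomial `P^k_B[u]`: it has degree at most `k` and its
derivatives up to order `k` match, in the mean over `B`, the weak derivatives `D` of `u`. -/
def IsCampPoly (n k : ℕ) (D : (h : ℕ) → Euc n → (Fin h → Fin n) → ℝ)
    (B : Set (Euc n)) (P : MvPolynomial (Fin n) ℝ) : Prop :=
  P.totalDegree ≤ k ∧
  ∀ h : ℕ, h ≤ k → ∀ dirs : Fin h → Fin n,
    ∫ x in B, D h x dirs =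
      ∫ x in B,
        iteratedFDeriv ℝ h (fun y : Euc n => MvPolynomial.eval (fun i => y i) P) x
          (fun i => EuclideanSpace.single (dirs i) (1 : ℝ))

/-- The normalized oscillation of order `k` over the ball `B(x,r)`. -/
def oscQuotK (n k : ℕ) (φ : ℝ → ℝ) (u : Euc n → ℝ)
    (D : (h : ℕ) → Euc n → (Fin h → Fin n) → ℝ) (x : Euc n) (r : ℝ) : ℝ≥0∞ :=
  ⨅ (P : MvPolynomial (Fin n) ℝ) (_ : IsCampPoly n k D (ball x r) P),
    ENNReal.ofReal
      ((φ ((volume (ball x r)).toReal ^ ((n : ℝ)⁻¹)) *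
          (volume (ball x r)).toReal ^ ((k : ℝ) / (n : ℝ)))⁻¹ *
        ⨍ y in ball x r, |u y - MvPolynomial.eval (fun i => y i) P|)

/-- The `k`-th order Campanato seminorm `|u|_{𝓛^{k,φ}(ℝⁿ)}`. -/
def campSemK (n k : ℕ) (φ : ℝ → ℝ) (u : Euc n → ℝ)
    (D : (h : ℕ) → Euc n → (Fin h → Fin n) → ℝ) : ℝ≥0∞ :=
  ⨆ (x : Euc n) (r : ℝ) (_ : 0 < r), oscQuotK n k φ u D x r

/-- The `k`-th order Campanato quantity restricted to balls of measure at most `r`. -/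
def campSemKSmall (n k : ℕ) (φ : ℝ → ℝ) (u : Euc n → ℝ)
    (D : (h : ℕ) → Euc n → (Fin h → Fin n) → ℝ) (r : ℝ) : ℝ≥0∞ :=
  ⨆ (x : Euc n) (ρ : ℝ) (_ : 0 < ρ) (_ : volume (ball x ρ) ≤ ENNReal.ofReal r),
    oscQuotK n k φ u D x ρ

/-- The Luxemburg norm `‖f‖_{L^A(μ)}`. -/
def luxNorm {α : Type*} [MeasurableSpace α] (A : ℝ → ℝ≥0∞) (μ : Measure α)
    (f : α → ℝ) : ℝ≥0∞ :=
  sInf (ENNReal.ofReal '' {lam : ℝ | 0 < lam ∧ ∫⁻ x, A (|f x| / lam) ∂μ ≤ 1})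

/-- Iterated integral `∫_r^∞ ∫_{r_1}^∞ ⋯ g`. -/
def iterInt : ℕ → (ℝ → ℝ) → (ℝ → ℝ)
  | 0, g => g
  | j + 1, g => fun r => ∫ t in Set.Ioi r, iterInt j g t

end

/-! ### Young functions and their conjugates -/

theorem IsYoung.apply_mul_le {A : ℝ → ℝ≥0∞} (hA : IsYoung A) {w t : ℝ} (hw : 0 ≤ w) (hw1 : w ≤ 1)
    (ht : 0 ≤ t) : A (w * t) ≤ ENNReal.ofReal w * A t := by
  have h := hA.2.1 t 0 w ht le_rfl hw hw1
  simpa [hA.1] using h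

theorem IsYoung.mono {A : ℝ → ℝ≥0∞} (hA : IsYoung A) {x y : ℝ} (hx : 0 ≤ x) (hxy : x ≤ y) :
    A x ≤ A y := by
  rcases eq_or_lt_of_le (hx.trans hxy) with h | h
  · have : x = y := by linarith
    rw [this]
  · have h1 := hA.apply_mul_le (w := x / y) (t := y) (by positivity)
      (div_le_one_of_le₀ hxy h.le) h.le
    rw [div_mul_cancel₀ _ h.ne'] at h1
    refine h1.trans ?_
    calc ENNReal.ofReal (x / y) * A y ≤ 1 * A y := by
          gcongr
          exact ENNReal.ofReal_le_one.2 (div_le_one_of_le₀ hxy h.le)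
      _ = A y := one_mul _

theorem IsYoung.exists_pos_ne_top {A : ℝ → ℝ≥0∞} (hA : IsYoung A) : ∃ t, 0 < t ∧ A t ≠ ⊤ := by
  obtain ⟨-, -, -, t₁, t₂, h1, h2, hne⟩ := hA
  by_contra! h
  exact hne ((h t₁ h1).trans (h t₂ h2).symm)

theorem youngConj_mono {A : ℝ → ℝ≥0∞} {x y : ℝ} (hxy : x ≤ y) : youngConj A x ≤ youngConj A y := by
  refine iSup₂_mono fun τ hτ => ?_
  gcongr

theorem ofReal_mul_le_add_youngConj (A : ℝ → ℝ≥0∞) {τ : ℝ} (hτ : 0 ≤ τ) (t : ℝ) :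
    ENNReal.ofReal (τ * t) ≤ A τ + youngConj A t := by
  rw [← tsub_le_iff_left]
  exact le_iSup₂_of_le (f := fun (τ : ℝ) (_ : 0 ≤ τ) => ENNReal.ofReal (τ * t) - A τ) τ hτ le_rfl

theorem youngConj_le_of_rpow_le {A : ℝ → ℝ≥0∞} {c q T : ℝ} (hc : 0 < c) (hq : 1 < q) (hT : 0 ≤ T)
    (h : ∀ τ, T < τ → ENNReal.ofReal (c * τ ^ q) ≤ A τ) {t : ℝ} (ht : 0 < t) :
    youngConj A t ≤ ENNReal.ofReal (T * t + c⁻¹ ^ (1 / (q - 1)) * t ^ (q / (q - 1))) := by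
  have hq1 : 0 < q - 1 := by linarith
  refine iSup₂_le fun τ hτ => ?_
  rcases le_or_gt τ T with hτT | hτT
  · refine tsub_le_self.trans (ENNReal.ofReal_le_ofReal ?_)
    have : 0 ≤ c⁻¹ ^ (1 / (q - 1)) * t ^ (q / (q - 1)) := by positivity
    have : τ * t ≤ T * t := by gcongr
    linarith
  · have hτ0 : 0 < τ := hT.trans_lt hτT
    rcases le_or_gt t (c * τ ^ (q - 1)) with h1 | h1
    · rw [tsub_eq_zero_of_le]
      · exact zero_le
      refine le_trans (ENNReal.ofReal_le_ofReal ?_) (h τ hτT)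
      calc τ * t ≤ τ * (c * τ ^ (q - 1)) := by gcongr
        _ = c * (τ ^ (q - 1) * τ ^ (1 : ℝ)) := by rw [Real.rpow_one]; ring
        _ = c * τ ^ q := by rw [← Real.rpow_add hτ0]; congr 2; ring
    · refine tsub_le_self.trans (ENNReal.ofReal_le_ofReal ?_)
      have h2 : τ ≤ (c⁻¹ * t) ^ (1 / (q - 1)) := by
        have h3 : τ ^ (q - 1) ≤ c⁻¹ * t := by
          rw [inv_mul_eq_div, le_div_iff₀ hc, mul_comm]; exact h1.le
        calc τ = (τ ^ (q - 1)) ^ (1 / (q - 1)) := by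
              rw [← Real.rpow_mul hτ, mul_one_div_cancel hq1.ne', Real.rpow_one]
          _ ≤ _ := by gcongr
      have h4 : t ^ (q / (q - 1)) = t ^ (1 / (q - 1)) * t := by
        rw [← Real.rpow_add_one ht.ne']; congr 1; field_simp; ring
      have : 0 ≤ T * t := by positivity
      have h5 : τ * t ≤ (c⁻¹ * t) ^ (1 / (q - 1)) * t := by gcongr
      rw [Real.mul_rpow (by positivity) ht.le] at h5
      rw [h4]; linarith

/-- The integral `∫_0^t Ã(τ) τ^{-1-p} dτ`. -/
noncomputable def conjInt (A : ℝ → ℝ≥0∞) (p t : ℝ) : ℝ≥0∞ :=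
  ∫⁻ τ in Set.Ioc (0 : ℝ) t, youngConj A τ * ENNReal.ofReal (τ ^ (-1 - p))

theorem youngConj_le_conjInt (A : ℝ → ℝ≥0∞) {p : ℝ} (hp : 0 < p) {t : ℝ} (ht : 0 < t) :
    youngConj A t ≤ ENNReal.ofReal (2 ^ (1 + p) * t ^ p) * conjInt A p (2 * t) := by
  have h1 : youngConj A t * ENNReal.ofReal ((2 * t) ^ (-1 - p)) * ENNReal.ofReal t ≤
      conjInt A p (2 * t) := by
    calc _ = ∫⁻ τ in Set.Ioc t (2 * t),
          youngConj A t * ENNReal.ofReal ((2 * t) ^ (-1 - p)) := by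
          rw [setLIntegral_const, Real.volume_Ioc]; congr 2; ring
      _ ≤ ∫⁻ τ in Set.Ioc t (2 * t), youngConj A τ * ENNReal.ofReal (τ ^ (-1 - p)) := by
          refine setLIntegral_mono' measurableSet_Ioc fun τ hτ => ?_
          have hτ0 : 0 < τ := ht.trans hτ.1
          refine mul_le_mul' (youngConj_mono hτ.1.le) (ENNReal.ofReal_le_ofReal ?_)
          exact Real.rpow_le_rpow_of_nonpos hτ0 hτ.2 (by linarith)
      _ ≤ _ := lintegral_mono_set (Set.Ioc_subset_Ioc_left ht.le)
  calc youngConj A t = ENNReal.ofReal (2 ^ (1 + p) * t ^ p) *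
        (youngConj A t * ENNReal.ofReal ((2 * t) ^ (-1 - p)) * ENNReal.ofReal t) := by
        rw [mul_assoc, ← ENNReal.ofReal_mul (by positivity), mul_left_comm,
          ← ENNReal.ofReal_mul (by positivity)]
        have : 2 ^ (1 + p) * t ^ p * ((2 * t) ^ (-1 - p) * t) = 1 := by
          rw [show -1 - p = -(1 + p) by ring, Real.rpow_neg (by positivity),
            Real.mul_rpow (by norm_num) ht.le, Real.rpow_add ht 1 p, Real.rpow_one]
          have : (0 : ℝ) < t ^ p := by positivity
          field_simp
        rw [this]; simp
    _ ≤ _ := by gcongr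

theorem lintegral_Ioc_rpow_le {C r p t : ℝ} (hC : 0 ≤ C) (hr : p < r) (ht : 0 < t) :
    ∫⁻ τ in Set.Ioc (0 : ℝ) t, ENNReal.ofReal (C * τ ^ r) * ENNReal.ofReal (τ ^ (-1 - p)) =
      ENNReal.ofReal (C / (r - p) * t ^ (r - p)) := by
  have hint : IntervalIntegrable (fun τ : ℝ => C * τ ^ (r - p - 1)) volume 0 t :=
    (intervalIntegral.intervalIntegrable_rpow' (by linarith)).const_mul _
  calc _ = ∫⁻ τ in Set.Ioc (0 : ℝ) t, ENNReal.ofReal (C * τ ^ (r - p - 1)) := by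
        refine setLIntegral_congr_fun measurableSet_Ioc fun τ hτ => ?_
        have hτ0 : (0 : ℝ) < τ := hτ.1
        rw [← ENNReal.ofReal_mul (by positivity), mul_assoc, ← Real.rpow_add hτ0]
        congr 3; ring
    _ = ENNReal.ofReal (∫ τ in Set.Ioc (0 : ℝ) t, C * τ ^ (r - p - 1)) := by
        rw [ofReal_integral_eq_lintegral_ofReal]
        · exact (intervalIntegrable_iff_integrableOn_Ioc_of_le ht.le).1 hint
        · refine (ae_restrict_iff' measurableSet_Ioc).2 (Eventually.of_forall fun τ hτ => ?_)
          have hτ0 : (0 : ℝ) < τ := hτ.1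
          simp only [Pi.zero_apply]
          positivity
    _ = _ := by
        rw [← intervalIntegral.integral_of_le ht.le, intervalIntegral.integral_const_mul,
          integral_rpow (Or.inl (by linarith)), sub_add_cancel, Real.zero_rpow (by linarith)]
        congr 1; ring

theorem conjInt_le {A : ℝ → ℝ≥0∞} {C r p : ℝ} (hC : 0 ≤ C) (hr : p < r)
    (h : ∀ t, 0 < t → youngConj A t ≤ ENNReal.ofReal (C * t ^ r)) {t : ℝ} (ht : 0 < t) :
    conjInt A p t ≤ ENNReal.ofReal (C / (r - p) * t ^ (r - p)) := by
  rw [← lintegral_Ioc_rpow_le hC hr ht]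
  refine setLIntegral_mono' measurableSet_Ioc fun τ hτ => ?_
  gcongr
  exact h τ hτ.1

theorem tendsto_conjInt {A : ℝ → ℝ≥0∞} {C r p : ℝ} (hC : 0 ≤ C) (hr : p < r)
    (h : ∀ t, 0 < t → youngConj A t ≤ ENNReal.ofReal (C * t ^ r))
    (h0 : ∀ ε, 0 < ε → ∃ T, 0 < T ∧ ∀ t, T ≤ t → youngConj A t ≤ ENNReal.ofReal (ε * t ^ r)) :
    Tendsto (fun t : ℝ => ENNReal.ofReal (t ^ (-(r - p))) * conjInt A p t) atTop (𝓝 0) := by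
  have hrp : 0 < r - p := by linarith
  rw [ENNReal.tendsto_nhds_zero]
  intro ε hε
  obtain ⟨e, he, heε⟩ : ∃ e : ℝ, 0 < e ∧ ENNReal.ofReal e ≤ ε := by
    rcases eq_or_ne ε ⊤ with rfl | hne
    · exact ⟨1, one_pos, le_top⟩
    · exact ⟨ε.toReal, ENNReal.toReal_pos hε.ne' hne, ENNReal.ofReal_toReal_le⟩
  obtain ⟨T, hT, hT'⟩ := h0 (e / 2 * (r - p)) (by positivity)
  have key : ∀ t, T ≤ t → conjInt A p t ≤
      ENNReal.ofReal (C / (r - p) * T ^ (r - p) + e / 2 * t ^ (r - p)) := by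
    intro t ht
    have ht0 : 0 < t := hT.trans_le ht
    have : conjInt A p t ≤ conjInt A p T +
        ∫⁻ τ in Set.Ioc T t, youngConj A τ * ENNReal.ofReal (τ ^ (-1 - p)) := by
      rw [conjInt, conjInt, ← Set.Ioc_union_Ioc_eq_Ioc hT.le ht]
      exact lintegral_union_le _ _ _
    refine this.trans ?_
    rw [ENNReal.ofReal_add (by positivity) (by positivity)]
    refine add_le_add (conjInt_le hC hr h hT) ?_
    calc _ ≤ ∫⁻ τ in Set.Ioc T t, ENNReal.ofReal (e / 2 * (r - p) * τ ^ r) *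
            ENNReal.ofReal (τ ^ (-1 - p)) := by
          refine setLIntegral_mono' measurableSet_Ioc fun τ hτ => ?_
          gcongr
          exact hT' τ hτ.1.le
      _ ≤ ∫⁻ τ in Set.Ioc 0 t, ENNReal.ofReal (e / 2 * (r - p) * τ ^ r) *
            ENNReal.ofReal (τ ^ (-1 - p)) := lintegral_mono_set (Set.Ioc_subset_Ioc_left hT.le)
      _ = _ := by
          rw [lintegral_Ioc_rpow_le (by positivity) hr ht0, mul_div_assoc, div_self hrp.ne',
            mul_one]
  have hlim : Tendsto (fun t : ℝ => C / (r - p) * T ^ (r - p) * t ^ (-(r - p))) atTop (𝓝 0) := by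
    simpa using (tendsto_rpow_neg_atTop hrp).const_mul (C / (r - p) * T ^ (r - p))
  have hev := hlim.eventually_le_const (half_pos he)
  filter_upwards [hev, eventually_ge_atTop T] with t h1 h2
  have ht0 : 0 < t := hT.trans_le h2
  refine le_trans ?_ heε
  calc _ ≤ ENNReal.ofReal (t ^ (-(r - p))) *
        ENNReal.ofReal (C / (r - p) * T ^ (r - p) + e / 2 * t ^ (r - p)) := by
        gcongr
        exact key t h2
    _ ≤ ENNReal.ofReal e := by
        rw [← ENNReal.ofReal_mul (by positivity)]
        apply ENNReal.ofReal_le_ofReal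
        have : t ^ (-(r - p)) * t ^ (r - p) = 1 := by
          rw [← Real.rpow_add ht0]; simp
        nlinarith

/-- The growth of the conjugate forced by power lower bounds on a Young function. -/
theorem conjInt_bounds_of_rpow_le {A : ℝ → ℝ≥0∞} {q p : ℝ} (hq : 1 < q) (hp : p < q / (q - 1))
    {c : ℝ} (hc : 0 < c) (h : ∀ t, 0 < t → ENNReal.ofReal (c * t ^ q) ≤ A t)
    (h0 : ∀ M, 0 < M → ∃ T, 0 < T ∧ ∀ t, T < t → ENNReal.ofReal (M * t ^ q) ≤ A t) :
    (∃ C, 0 < C ∧ ∀ t, 0 < t → conjInt A p t ≤ ENNReal.ofReal (C * t ^ (q / (q - 1) - p))) ∧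
    Tendsto (fun t : ℝ => ENNReal.ofReal (t ^ (-(q / (q - 1) - p))) * conjInt A p t)
      atTop (𝓝 0) := by
  have hq1 : 0 < q - 1 := by linarith
  have hb : ∀ t, 0 < t →
      youngConj A t ≤ ENNReal.ofReal (c⁻¹ ^ (1 / (q - 1)) * t ^ (q / (q - 1))) := by
    intro t ht
    simpa using youngConj_le_of_rpow_le hc hq le_rfl h ht
  have hC : 0 < c⁻¹ ^ (1 / (q - 1)) := by positivity
  refine ⟨⟨c⁻¹ ^ (1 / (q - 1)) / (q / (q - 1) - p), div_pos hC (by linarith), fun t ht =>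
    conjInt_le hC.le hp hb ht⟩, tendsto_conjInt hC.le hp hb ?_⟩
  intro ε hε
  obtain ⟨T, hT, hT'⟩ := h0 ((ε / 2) ^ (-(q - 1))) (by positivity)
  have hM : ((ε / 2) ^ (-(q - 1)))⁻¹ ^ (1 / (q - 1)) = ε / 2 := by
    rw [Real.rpow_neg (by positivity), inv_inv, ← Real.rpow_mul (by positivity),
      mul_one_div_cancel hq1.ne', Real.rpow_one]
  have hlim : Tendsto (fun t : ℝ => T * t ^ (-(1 / (q - 1)))) atTop (𝓝 0) := by
    simpa using (tendsto_rpow_neg_atTop (y := 1 / (q - 1)) (by positivity)).const_mul T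
  obtain ⟨T', hT1⟩ := eventually_atTop.1 (hlim.eventually_le_const (half_pos hε))
  refine ⟨max T' 1, by positivity, fun t ht => ?_⟩
  have ht0 : 0 < t := lt_of_lt_of_le (by positivity) ht
  refine (youngConj_le_of_rpow_le (by positivity) hq hT.le hT' ht0).trans
    (ENNReal.ofReal_le_ofReal ?_)
  rw [hM]
  have h1 := hT1 t ((le_max_left _ _).trans ht)
  have h2 : t = t ^ (-(1 / (q - 1))) * t ^ (q / (q - 1)) := by
    rw [← Real.rpow_add ht0]
    have : -(1 / (q - 1)) + q / (q - 1) = 1 := by field_simp; ring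
    rw [this, Real.rpow_one]
  have h3 : (0 : ℝ) < t ^ (q / (q - 1)) := by positivity
  have h4 : T * t = T * t ^ (-(1 / (q - 1))) * t ^ (q / (q - 1)) := by
    rw [mul_assoc, ← h2]
  nlinarith

/-- The bound on the conjugate used for oscillations at scale `r`, with weight `a + b √r`. -/
def ConjBound (A : ℝ → ℝ≥0∞) (n : ℕ) (s δ a b : ℝ) : Prop :=
  ∀ r : ℝ, 0 < r → ENNReal.ofReal (r ^ n) * youngConj A (r ^ (s - n) / δ) ≤
    ENNReal.ofReal (a + b * √r)

theorem conjBound_of_conjInt {A : ℝ → ℝ≥0∞} {n : ℕ} {s p : ℝ} (hs : s < n) (hp : 0 < p) {c : ℝ}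
    (hc : 0 < c)
    (h : ∀ t, 0 < t → conjInt A p t ≤ ENNReal.ofReal (c * t ^ ((n : ℝ) / (n - s) - p))) :
    ∃ C, 0 < C ∧ (∀ t, 0 < t → youngConj A t ≤ ENNReal.ofReal (C * t ^ ((n : ℝ) / (n - s)))) ∧
      ∀ δ, 0 < δ → ConjBound A n s δ (C * δ⁻¹ ^ ((n : ℝ) / (n - s))) 0 := by
  have hns : 0 < (n : ℝ) - s := by linarith
  set e := (n : ℝ) / (n - s) with he
  have hb : ∀ t, 0 < t →
      youngConj A t ≤ ENNReal.ofReal (2 ^ (1 + p) * c * 2 ^ (e - p) * t ^ e) := by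
    intro t ht
    refine (youngConj_le_conjInt A hp ht).trans ?_
    calc _ ≤ ENNReal.ofReal (2 ^ (1 + p) * t ^ p) * ENNReal.ofReal (c * (2 * t) ^ (e - p)) := by
          gcongr
          exact h _ (by positivity)
      _ = _ := by
          rw [← ENNReal.ofReal_mul (by positivity), Real.mul_rpow (by norm_num) ht.le,
            show t ^ e = t ^ p * t ^ (e - p) by rw [← Real.rpow_add ht]; congr 1; ring]
          congr 1; ring
  refine ⟨_, by positivity, hb, fun δ hδ r hr => ?_⟩
  calc _ ≤ ENNReal.ofReal (r ^ n) *
        ENNReal.ofReal (2 ^ (1 + p) * c * 2 ^ (e - p) * (r ^ (s - n) / δ) ^ e) := by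
        gcongr
        exact hb _ (by positivity)
    _ = _ := by
        rw [← ENNReal.ofReal_mul (by positivity), div_eq_mul_inv,
          Real.mul_rpow (by positivity) (by positivity), ← Real.rpow_mul hr.le]
        have : (s - n) * e = -n := by rw [he]; field_simp; ring
        rw [this, Real.rpow_neg hr.le, Real.rpow_natCast]
        congr 1
        field_simp
        ring

theorem conjBound_one_of_tendsto {A : ℝ → ℝ≥0∞} {n : ℕ} {s p : ℝ} (hs : s < n)
    (hp : 0 < p) {c : ℝ} (hc : 0 < c)
    (h : ∀ t, 0 < t → conjInt A p t ≤ ENNReal.ofReal (c * t ^ ((n : ℝ) / (n - s) - p)))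
    (h0 : Tendsto (fun t : ℝ => ENNReal.ofReal (t ^ (-((n : ℝ) / (n - s) - p))) * conjInt A p t)
      atTop (𝓝 0)) {δ : ℝ} (hδ : 0 < δ) :
    ∃ b, 0 ≤ b ∧ ConjBound A n s δ 1 b := by
  have hns : 0 < (n : ℝ) - s := by linarith
  obtain ⟨C, hC, -, hCb⟩ := conjBound_of_conjInt hs hp hc h
  specialize hCb δ hδ
  set e := (n : ℝ) / (n - s) with he
  set ε : ℝ := δ ^ e / (2 ^ (1 + p) * 2 ^ (e - p)) with hε
  have hε0 : 0 < ε := by positivity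
  obtain ⟨T, hT⟩ := eventually_atTop.1 ((ENNReal.tendsto_nhds_zero.1 h0) (ENNReal.ofReal ε)
    (ENNReal.ofReal_pos.2 hε0))
  have hlarge : ∀ t, max T 1 ≤ t → youngConj A t ≤ ENNReal.ofReal (δ ^ e * t ^ e) := by
    intro t ht
    have ht0 : 0 < t := lt_of_lt_of_le (by positivity) ht
    have h1 := hT (2 * t) (by linarith [le_max_left T 1])
    have h2 : conjInt A p (2 * t) ≤ ENNReal.ofReal (ε * (2 * t) ^ (e - p)) := by
      calc conjInt A p (2 * t) = ENNReal.ofReal ((2 * t) ^ (e - p)) *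
            (ENNReal.ofReal ((2 * t) ^ (-(e - p))) * conjInt A p (2 * t)) := by
            rw [← mul_assoc, ← ENNReal.ofReal_mul (by positivity),
              ← Real.rpow_add (by positivity)]
            simp
        _ ≤ ENNReal.ofReal ((2 * t) ^ (e - p)) * ENNReal.ofReal ε := by gcongr
        _ = _ := by rw [← ENNReal.ofReal_mul (by positivity), mul_comm]
    refine (youngConj_le_conjInt A hp ht0).trans ?_
    calc _ ≤ ENNReal.ofReal (2 ^ (1 + p) * t ^ p) * ENNReal.ofReal (ε * (2 * t) ^ (e - p)) := by
          gcongr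
      _ = _ := by
          rw [← ENNReal.ofReal_mul (by positivity), Real.mul_rpow (by norm_num) ht0.le,
            show t ^ e = t ^ p * t ^ (e - p) by rw [← Real.rpow_add ht0]; congr 1; ring, hε]
          congr 1
          field_simp
  set r₀ : ℝ := (max T 1 * δ) ^ (-(1 / (n - s))) with hr₀
  have hr₀0 : 0 < r₀ := by positivity
  refine ⟨C * δ⁻¹ ^ e / √r₀, by positivity, fun r hr => ?_⟩
  rcases le_or_gt r r₀ with hrr | hrr
  · have h3 : max T 1 ≤ r ^ (s - n) / δ := by
      rw [le_div_iff₀ hδ]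
      calc max T 1 * δ = r₀ ^ (s - n) := by
            rw [hr₀, ← Real.rpow_mul (by positivity)]
            have : -(1 / (n - s)) * (s - n) = 1 := by field_simp; ring
            rw [this, Real.rpow_one]
        _ ≤ r ^ (s - n) := Real.rpow_le_rpow_of_nonpos hr hrr (by linarith)
    calc _ ≤ ENNReal.ofReal (r ^ n) * ENNReal.ofReal (δ ^ e * (r ^ (s - n) / δ) ^ e) := by
          gcongr
          exact hlarge _ h3
      _ = ENNReal.ofReal 1 := by
          rw [← ENNReal.ofReal_mul (by positivity), Real.div_rpow (by positivity) hδ.le,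
            ← Real.rpow_mul hr.le]
          have : (s - n) * e = -n := by rw [he]; field_simp; ring
          rw [this, Real.rpow_neg hr.le, Real.rpow_natCast]
          congr 1
          field_simp
      _ ≤ _ := by
          apply ENNReal.ofReal_le_ofReal
          have : 0 ≤ C * δ⁻¹ ^ e / √r₀ * √r := by positivity
          linarith
  · refine (hCb r hr).trans (ENNReal.ofReal_le_ofReal ?_)
    have h4 : √r₀ ≤ √r := Real.sqrt_le_sqrt hrr.le
    have h5 : 0 < √r₀ := Real.sqrt_pos.2 hr₀0
    have : C * δ⁻¹ ^ e ≤ C * δ⁻¹ ^ e / √r₀ * √r := by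
      rw [div_mul_eq_mul_div, le_div_iff₀ h5]
      gcongr
    linarith

/-! ### Oscillation estimates on balls -/

theorem volume_ball_eq {n : ℕ} (x : Euc n) {r : ℝ} (hr : 0 < r) :
    volume (ball x r) = ENNReal.ofReal (r ^ n) * volume (ball (0 : Euc n) 1) := by
  rw [Measure.addHaar_ball_of_pos _ _ hr, finrank_euclideanSpace_fin]

/-- The integral of `|f y - f z|` over `S × T`. -/
noncomputable def oscInt {n : ℕ} (f : Euc n → ℝ) (S T : Set (Euc n)) : ℝ≥0∞ :=
  ∫⁻ y in S, ∫⁻ z in T, ‖f y - f z‖ₑ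

theorem oscInt_mono {n : ℕ} (f : Euc n → ℝ) {S T S' T' : Set (Euc n)} (hS : S ⊆ S') (hT : T ⊆ T') :
    oscInt f S T ≤ oscInt f S' T' :=
  (lintegral_mono fun _ => lintegral_mono_set hT).trans (lintegral_mono_set hS)

theorem oscInt_triangle {n : ℕ} {f : Euc n → ℝ} (hf : Measurable f) (S T U : Set (Euc n)) :
    volume T * oscInt f S U ≤ volume U * oscInt f S T + volume S * oscInt f T U := by
  have hm : Measurable fun p : Euc n × Euc n => ‖f p.1 - f p.2‖ₑ :=
    ((hf.comp measurable_fst).sub (hf.comp measurable_snd)).enorm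
  have h1 : ∀ y, volume T * ∫⁻ z in U, ‖f y - f z‖ₑ ≤
      volume U * (∫⁻ w in T, ‖f y - f w‖ₑ) + oscInt f T U := by
    intro y
    calc volume T * ∫⁻ z in U, ‖f y - f z‖ₑ = ∫⁻ w in T, ∫⁻ z in U, ‖f y - f z‖ₑ := by
          rw [setLIntegral_const, mul_comm]
      _ ≤ ∫⁻ w in T, ∫⁻ z in U, (‖f y - f w‖ₑ + ‖f w - f z‖ₑ) := by
          gcongr with w z
          calc ‖f y - f z‖ₑ = ‖(f y - f w) + (f w - f z)‖ₑ := by congr 1; ring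
            _ ≤ _ := enorm_add_le _ _
      _ = ∫⁻ w in T, (volume U * ‖f y - f w‖ₑ + ∫⁻ z in U, ‖f w - f z‖ₑ) := by
          refine lintegral_congr fun w => ?_
          rw [lintegral_add_left measurable_const, setLIntegral_const, mul_comm]
      _ = _ := by
          have hm1 : Measurable fun w => ‖f y - f w‖ₑ := (measurable_const.sub hf).enorm
          rw [lintegral_add_left (hm1.const_mul _), lintegral_const_mul _ hm1, oscInt]
  have hm2 : Measurable fun y => ∫⁻ w in T, ‖f y - f w‖ₑ := hm.lintegral_prod_right'
  have hm3 : Measurable fun y => ∫⁻ w in U, ‖f y - f w‖ₑ := hm.lintegral_prod_right'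
  calc volume T * oscInt f S U = ∫⁻ y in S, volume T * ∫⁻ z in U, ‖f y - f z‖ₑ := by
        rw [lintegral_const_mul _ hm3, oscInt]
    _ ≤ ∫⁻ y in S, (volume U * (∫⁻ w in T, ‖f y - f w‖ₑ) + oscInt f T U) := by
        gcongr with y
        exact h1 y
    _ = _ := by
        rw [lintegral_add_right _ measurable_const, lintegral_const_mul _ hm2, setLIntegral_const,
          mul_comm (oscInt f T U), oscInt, oscInt]

theorem lintegral_le_of_oscInt {n : ℕ} {f : Euc n → ℝ} (hf : Measurable f) (S G : Set (Euc n))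
    {t : ℝ} (hG : MeasurableSet G) (ht : ∀ z ∈ G, |f z| ≤ t) :
    volume G * ∫⁻ y in S, ‖f y‖ₑ ≤ oscInt f S G + ENNReal.ofReal t * volume S * volume G := by
  have h1 : ∀ y, volume G * ‖f y‖ₑ ≤ (∫⁻ z in G, ‖f y - f z‖ₑ) + ENNReal.ofReal t * volume G := by
    intro y
    calc volume G * ‖f y‖ₑ = ∫⁻ z in G, ‖f y‖ₑ := by rw [setLIntegral_const, mul_comm]
      _ ≤ ∫⁻ z in G, (‖f y - f z‖ₑ + ENNReal.ofReal t) := by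
          refine setLIntegral_mono' hG fun z hz => ?_
          calc ‖f y‖ₑ = ‖(f y - f z) + f z‖ₑ := by congr 1; ring
            _ ≤ ‖f y - f z‖ₑ + ‖f z‖ₑ := enorm_add_le _ _
            _ ≤ _ := by
                gcongr
                rw [Real.enorm_eq_ofReal_abs]
                exact ENNReal.ofReal_le_ofReal (ht z hz)
      _ = _ := by rw [lintegral_add_right _ measurable_const, setLIntegral_const]
  calc volume G * ∫⁻ y in S, ‖f y‖ₑ = ∫⁻ y in S, volume G * ‖f y‖ₑ := by
        rw [lintegral_const_mul _ hf.enorm]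
    _ ≤ ∫⁻ y in S, ((∫⁻ z in G, ‖f y - f z‖ₑ) + ENNReal.ofReal t * volume G) := by
        gcongr with y
        exact h1 y
    _ = _ := by
        rw [lintegral_add_right _ measurable_const, setLIntegral_const, oscInt]
        ring

/-- Scale weights growing at most by the factor `3/2` under doubling. -/
def SlowWeight (Φ : ℝ → ℝ) : Prop := ∀ r, 0 < r → 0 ≤ Φ r ∧ Φ (2 * r) ≤ 3 / 2 * Φ r

theorem slowWeight_add_sqrt {a b : ℝ} (ha : 0 ≤ a) (hb : 0 ≤ b) :
    SlowWeight fun r => a + b * √r := by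
  intro r hr
  refine ⟨by positivity, ?_⟩
  have h1 : √(2 * r) ≤ 3 / 2 * √r := by
    rw [Real.sqrt_mul (by norm_num)]
    gcongr
    rw [Real.sqrt_le_left (by norm_num)]
    norm_num
  nlinarith [Real.sqrt_nonneg r, mul_le_mul_of_nonneg_left h1 hb]

theorem SlowWeight.pow {Φ : ℝ → ℝ} (hΦ : SlowWeight Φ) {r : ℝ} (hr : 0 < r) (k : ℕ) :
    Φ (2 ^ k * r) ≤ (3 / 2) ^ k * Φ r := by
  induction k with
  | zero => simp
  | succ k ih =>
    have := (hΦ (2 ^ k * r) (by positivity)).2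
    calc Φ (2 ^ (k + 1) * r) = Φ (2 * (2 ^ k * r)) := by congr 1; ring
      _ ≤ 3 / 2 * Φ (2 ^ k * r) := this
      _ ≤ 3 / 2 * ((3 / 2) ^ k * Φ r) := by gcongr
      _ = _ := by ring

theorem volume_ball_pos_ne {n : ℕ} (x : Euc n) {r : ℝ} (hr : 0 < r) :
    volume (ball x r) ≠ 0 ∧ volume (ball x r) ≠ ⊤ :=
  ⟨(measure_ball_pos _ _ hr).ne', measure_ball_lt_top.ne⟩

/-- Mean oscillations of order `r^{-h}`, `h ≥ 1`, compare a ball with its dyadic dilations. -/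
theorem oscInt_ball_two_pow_le {n h : ℕ} (hh : 1 ≤ h) {f : Euc n → ℝ} (hf : Measurable f)
    {Φ : ℝ → ℝ} (hΦ : SlowWeight Φ) {K : ℝ≥0∞}
    (hosc : ∀ (x : Euc n) (r : ℝ), 0 < r → oscInt f (ball x r) (ball x r) ≤
      K * volume (ball x r) ^ 2 * ENNReal.ofReal (Φ r / r ^ h)) (x : Euc n) {r : ℝ} (hr : 0 < r)
    (k : ℕ) :
    oscInt f (ball x r) (ball x (2 ^ k * r)) ≤ volume (ball x r) * volume (ball x (2 ^ k * r)) *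
      (K * 2 ^ n * ENNReal.ofReal (4 * (1 - (3 / 4) ^ (k + 1)) * (Φ r / r ^ h))) := by
  have hΦ0 := (hΦ r hr).1
  have hdec : ∀ j : ℕ, Φ (2 ^ j * r) / (2 ^ j * r) ^ h ≤ (3 / 4) ^ j * (Φ r / r ^ h) := by
    intro j
    have h2 : (2 : ℝ) ^ j ≤ (2 ^ j) ^ h := le_self_pow₀ (one_le_pow₀ (by norm_num)) (by omega)
    calc Φ (2 ^ j * r) / (2 ^ j * r) ^ h ≤ ((3 / 2) ^ j * Φ r) / (2 ^ j * r ^ h) := by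
          rw [mul_pow]
          gcongr
          exact hΦ.pow hr j
      _ = _ := by
          rw [show (3 / 4 : ℝ) = 3 / 2 / 2 by norm_num, div_pow (3 / 2 : ℝ) 2]
          field_simp
  induction k with
  | zero =>
    simp only [pow_zero, one_mul]
    refine (hosc x r hr).trans ?_
    have h1 : (1 : ℝ≥0∞) ≤ 2 ^ n := one_le_pow₀ (by norm_num)
    calc K * volume (ball x r) ^ 2 * ENNReal.ofReal (Φ r / r ^ h)
        = volume (ball x r) * volume (ball x r) * (K * 1 * ENNReal.ofReal (Φ r / r ^ h)) := by ring
      _ ≤ _ := by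
          gcongr
          have : 0 ≤ Φ r / r ^ h := by positivity
          norm_num
  | succ k ih =>
    set B₀ := ball x r
    set B₁ := ball x (2 ^ k * r)
    set B₂ := ball x (2 ^ (k + 1) * r) with hB₂
    have hv2 : volume B₂ = 2 ^ n * volume B₁ := by
      rw [volume_ball_eq x (by positivity), volume_ball_eq x (by positivity), ← mul_assoc]
      congr 1
      rw [show (2 : ℝ≥0∞) = ENNReal.ofReal 2 by simp, ← ENNReal.ofReal_pow (by norm_num),
        ← ENNReal.ofReal_mul (by positivity), ← mul_pow]
      congr 2; ring
    obtain ⟨hB1, hB1'⟩ := volume_ball_pos_ne x (r := 2 ^ k * r) (by positivity)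
    have hsub : B₁ ⊆ B₂ := by
      refine ball_subset_ball ?_
      gcongr
      · norm_num
      · omega
    have h12 : oscInt f B₁ B₂ ≤ volume B₁ * volume B₂ *
        (K * 2 ^ n * ENNReal.ofReal ((3 / 4) ^ (k + 1) * (Φ r / r ^ h))) := by
      refine (oscInt_mono f hsub subset_rfl).trans ((hosc x _ (by positivity)).trans ?_)
      calc K * volume B₂ ^ 2 * ENNReal.ofReal (Φ (2 ^ (k + 1) * r) / (2 ^ (k + 1) * r) ^ h)
          ≤ K * volume B₂ ^ 2 * ENNReal.ofReal ((3 / 4) ^ (k + 1) * (Φ r / r ^ h)) := by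
            gcongr
            exact hdec (k + 1)
        _ = K * ((2 ^ n * volume B₁) * volume B₂) *
            ENNReal.ofReal ((3 / 4) ^ (k + 1) * (Φ r / r ^ h)) := by rw [← hv2]; ring
        _ = _ := by ring
    have htri := oscInt_triangle hf B₀ B₁ B₂
    have hfin : volume B₁ * oscInt f B₀ B₂ ≤ volume B₁ * (volume B₀ * volume B₂ *
        (K * 2 ^ n * ENNReal.ofReal (4 * (1 - (3 / 4) ^ (k + 1 + 1)) * (Φ r / r ^ h)))) := by
      have h34 : (3 / 4 : ℝ) ^ (k + 1) ≤ 1 := pow_le_one₀ (by norm_num) (by norm_num)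
      have hadd : ENNReal.ofReal (4 * (1 - (3 / 4) ^ (k + 1 + 1)) * (Φ r / r ^ h)) =
          ENNReal.ofReal (4 * (1 - (3 / 4) ^ (k + 1)) * (Φ r / r ^ h)) +
          ENNReal.ofReal ((3 / 4) ^ (k + 1) * (Φ r / r ^ h)) := by
        have : 0 ≤ 1 - (3 / 4 : ℝ) ^ (k + 1) := by linarith
        rw [← ENNReal.ofReal_add (by positivity) (by positivity)]
        congr 1; ring
      rw [hadd]
      calc _ ≤ _ := htri
        _ ≤ _ := add_le_add (mul_le_mul_right ih _) (mul_le_mul_right h12 _)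
        _ = _ := by ring
    exact (ENNReal.mul_le_mul_iff_right hB1 hB1').1 hfin

/-- Oscillation decay together with weak decay at infinity bounds the function itself. -/
theorem lintegral_ball_le_of_oscInt {n h : ℕ} (hn : 0 < n) (hh : 1 ≤ h) {f : Euc n → ℝ}
    (hf : Measurable f) (hdecay : ∀ t, 0 < t → volume {x | t < |f x|} < ⊤)
    {Φ : ℝ → ℝ} (hΦ : SlowWeight Φ) {K : ℝ≥0∞}
    (hosc : ∀ (x : Euc n) (r : ℝ), 0 < r → oscInt f (ball x r) (ball x r) ≤
      K * volume (ball x r) ^ 2 * ENNReal.ofReal (Φ r / r ^ h)) (x : Euc n) {r : ℝ} (hr : 0 < r) :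
    ∫⁻ y in ball x r, ‖f y‖ₑ ≤
      8 * 2 ^ n * K * volume (ball x r) * ENNReal.ofReal (Φ r / r ^ h) := by
  have hΦ0 := (hΦ r hr).1
  obtain ⟨hV0, hVt⟩ := volume_ball_pos_ne (0 : Euc n) one_pos
  have key : ∀ t, 0 < t → ∫⁻ y in ball x r, ‖f y‖ₑ ≤
      8 * 2 ^ n * K * volume (ball x r) * ENNReal.ofReal (Φ r / r ^ h) +
        ENNReal.ofReal t * volume (ball x r) := by
    intro t ht
    have hbad := hdecay t ht
    have hbig : Tendsto (fun k : ℕ => volume (ball x (2 ^ k * r))) atTop (𝓝 ⊤) := by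
      have h1 : Tendsto (fun k : ℕ => ((2 : ℝ) ^ k * r) ^ n) atTop atTop :=
        (tendsto_pow_atTop hn.ne').comp
          ((tendsto_pow_atTop_atTop_of_one_lt (by norm_num)).atTop_mul_const hr)
      have h2 := ENNReal.Tendsto.mul_const (ENNReal.tendsto_ofReal_atTop.comp h1)
        (b := volume (ball (0 : Euc n) 1)) (Or.inl ENNReal.top_ne_zero)
      rw [ENNReal.top_mul hV0] at h2
      refine h2.congr fun k => ?_
      rw [volume_ball_eq x (by positivity)]
      rfl
    obtain ⟨k, hk⟩ := (hbig.eventually_const_le (u := 2 * volume {x | t < |f x|})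
      (ENNReal.mul_lt_top (by simp) hbad)).exists
    set B := ball x (2 ^ k * r)
    obtain ⟨hB0, hBt⟩ := volume_ball_pos_ne x (r := 2 ^ k * r) (by positivity)
    set G := B \ {x | t < |f x|} with hG
    have hmeas : MeasurableSet {x | t < |f x|} := measurableSet_lt measurable_const hf.abs
    have hGB : volume B ≤ 2 * volume G := by
      have h1 : volume B ≤ volume {x | t < |f x|} + volume G := by
        rw [add_comm, hG]
        exact (measure_mono (by intro z hz; by_cases h : t < |f z| <;> simp [h, hz])).trans
          (measure_union_le (B \ {x | t < |f x|}) {x | t < |f x|})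
      have h2 : volume B + volume B ≤ volume B + 2 * volume G := by
        calc volume B + volume B ≤ (volume {x | t < |f x|} + volume G) +
              (volume {x | t < |f x|} + volume G) := add_le_add h1 h1
          _ = 2 * volume {x | t < |f x|} + 2 * volume G := by ring
          _ ≤ _ := by gcongr
      exact (ENNReal.add_le_add_iff_left hBt).1 h2
    have hG0 : volume G ≠ 0 := by
      intro h0
      rw [h0, mul_zero] at hGB
      exact hB0 (le_zero_iff.1 hGB)
    have hGt : volume G ≠ ⊤ := ((measure_mono sdiff_subset).trans_lt hBt.lt_top).ne
    have h1 := lintegral_le_of_oscInt hf (ball x r) G (measurableSet_ball.diff hmeas)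
      (t := t) (fun z hz => by simpa using hz.2)
    have h2 := oscInt_ball_two_pow_le hh hf hΦ hosc x hr k
    have h3 : volume G * ∫⁻ y in ball x r, ‖f y‖ₑ ≤ volume G *
        (8 * 2 ^ n * K * volume (ball x r) * ENNReal.ofReal (Φ r / r ^ h) +
        ENNReal.ofReal t * volume (ball x r)) := by
      refine h1.trans ?_
      calc _ ≤ volume (ball x r) * (2 * volume G) *
            (K * 2 ^ n * ENNReal.ofReal (4 * (Φ r / r ^ h))) +
            ENNReal.ofReal t * volume (ball x r) * volume G := by
            gcongr
            refine (oscInt_mono f subset_rfl sdiff_subset).trans (h2.trans ?_)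
            gcongr
            have : (0 : ℝ) ≤ (3 / 4) ^ (k + 1) := by positivity
            have h4 : 0 ≤ Φ r / r ^ h := by positivity
            nlinarith
        _ = _ := by
            rw [ENNReal.ofReal_mul (by norm_num), show ENNReal.ofReal 4 = 4 by simp]
            ring
    exact (ENNReal.mul_le_mul_iff_right hG0 hGt).1 h3
  obtain ⟨-, hBt⟩ := volume_ball_pos_ne x hr
  have hlim : Tendsto (fun t : ℝ =>
      8 * 2 ^ n * K * volume (ball x r) * ENNReal.ofReal (Φ r / r ^ h) +
        ENNReal.ofReal t * volume (ball x r)) (𝓝[>] 0)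
      (𝓝 (8 * 2 ^ n * K * volume (ball x r) * ENNReal.ofReal (Φ r / r ^ h) + 0)) := by
    refine Tendsto.const_add _ ?_
    have h1 : Tendsto (fun t : ℝ => ENNReal.ofReal t) (𝓝[>] 0) (𝓝 0) := by
      have := (ENNReal.continuous_ofReal.tendsto 0).mono_left (nhdsWithin_le_nhds (s := Ioi 0))
      simpa using this
    simpa using ENNReal.Tendsto.mul_const h1 (b := volume (ball x r)) (Or.inr hBt)
  rw [add_zero] at hlim
  exact ge_of_tendsto hlim (eventually_mem_nhdsWithin.mono fun t ht => key t ht)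

/-! ### A Poincaré inequality for weak derivatives -/

/-- The `i`-th vector of the standard basis. -/
noncomputable abbrev stdVec {n : ℕ} (i : Fin n) : Euc n := EuclideanSpace.single i (1 : ℝ)

/-- `g` is the `i`-th weak partial derivative of `v`. -/
def IsWeakPartial {n : ℕ} (i : Fin n) (v g : Euc n → ℝ) : Prop :=
  ∀ φ : Euc n → ℝ, ContDiff ℝ (⊤ : ℕ∞) φ → HasCompactSupport φ →
    ∫ x, v x * fderiv ℝ φ x (stdVec i) = -∫ x, g x * φ x

theorem enorm_clm_apply_le {n : ℕ} (L : Euc n →L[ℝ] ℝ) (h : Euc n) :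
    ‖L h‖ₑ ≤ ENNReal.ofReal ‖h‖ * ∑ i, ‖L (stdVec i)‖ₑ := by
  have h1 : L h = ∑ i, h i * L (stdVec i) := by
    conv_lhs => rw [← (EuclideanSpace.basisFun (Fin n) ℝ).sum_repr h]
    simp [map_sum]
  rw [h1, Finset.mul_sum]
  refine (enorm_sum_le _ _).trans (Finset.sum_le_sum fun i _ => ?_)
  rw [enorm_mul, ofReal_norm]
  gcongr
  rw [← ofReal_norm, ← ofReal_norm]
  exact ENNReal.ofReal_le_ofReal (PiLp.norm_apply_le h i)

theorem enorm_sub_le_lintegral_fderiv {n : ℕ} {V : Euc n → ℝ} (hV : ContDiff ℝ 1 V) (y h : Euc n) :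
    ‖V (y + h) - V y‖ₑ ≤ ENNReal.ofReal ‖h‖ *
      ∫⁻ t in Set.Ioc (0 : ℝ) 1, ∑ i, ‖fderiv ℝ V (y + t • h) (stdVec i)‖ₑ := by
  have hd : ∀ t : ℝ, HasDerivAt (fun t : ℝ => V (y + t • h)) (fderiv ℝ V (y + t • h) h) t := by
    intro t
    have h1 : HasDerivAt (fun t : ℝ => y + t • h) h t := by
      simpa using ((hasDerivAt_id t).smul_const h).const_add y
    exact ((hV.differentiable (by norm_num)) _).hasFDerivAt.comp_hasDerivAt t h1
  have hc : Continuous fun t : ℝ => fderiv ℝ V (y + t • h) h :=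
    ((hV.continuous_fderiv (by norm_num)).comp (by fun_prop)).clm_apply continuous_const
  have h2 : V (y + h) - V y = ∫ t in (0 : ℝ)..1, fderiv ℝ V (y + t • h) h := by
    rw [intervalIntegral.integral_eq_sub_of_hasDerivAt (fun t _ => hd t)
      (hc.intervalIntegrable _ _)]
    simp
  rw [h2, intervalIntegral.integral_of_le zero_le_one, ← lintegral_const_mul' _ _ (by simp)]
  refine (enorm_integral_le_lintegral_enorm _).trans ?_
  gcongr with t
  exact enorm_clm_apply_le _ _

theorem lintegral_ball_comp_add_le {n : ℕ} (f : Euc n → ℝ≥0∞) (x a : Euc n)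
    {r R : ℝ} (hR : r + ‖a‖ ≤ R) :
    ∫⁻ y in ball x r, f (y + a) ≤ ∫⁻ y in ball x R, f y := by
  have h1 : ∫⁻ y in ball x r, f (y + a) ≤ ∫⁻ y, (ball x R).indicator f (y + a) := by
    rw [← lintegral_indicator measurableSet_ball]
    refine lintegral_mono fun y => ?_
    by_cases hy : y ∈ ball x r
    · have : y + a ∈ ball x R := by
        rw [mem_ball, dist_eq_norm] at hy ⊢
        calc ‖y + a - x‖ = ‖(y - x) + a‖ := by congr 1; abel
          _ ≤ ‖y - x‖ + ‖a‖ := norm_add_le _ _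
          _ < _ := by linarith
      simp [hy, this]
    · simp [hy]
  rwa [lintegral_add_right_eq_self (fun y => (ball x R).indicator f y) a,
    lintegral_indicator measurableSet_ball] at h1

theorem lintegral_translate_sub_le {n : ℕ} {V : Euc n → ℝ} (hV : ContDiff ℝ 1 V) (x h : Euc n)
    (r : ℝ) :
    ∫⁻ y in ball x r, ‖V (y + h) - V y‖ₑ ≤ ENNReal.ofReal ‖h‖ *
      ∑ i, ∫⁻ y in ball x (r + ‖h‖), ‖fderiv ℝ V y (stdVec i)‖ₑ := by
  have hc : ∀ i, Continuous fun y : Euc n => fderiv ℝ V y (stdVec i) := fun i =>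
    (hV.continuous_fderiv (by norm_num)).clm_apply continuous_const
  have hm : Measurable fun p : Euc n × ℝ => ∑ i, ‖fderiv ℝ V (p.1 + p.2 • h) (stdVec i)‖ₑ := by
    refine Finset.measurable_fun_sum _ fun i _ => ?_
    exact ((hc i).comp (by fun_prop)).enorm.measurable
  calc _ ≤ ∫⁻ y in ball x r, ENNReal.ofReal ‖h‖ *
        ∫⁻ t in Set.Ioc (0 : ℝ) 1, ∑ i, ‖fderiv ℝ V (y + t • h) (stdVec i)‖ₑ := by
        gcongr with y
        exact enorm_sub_le_lintegral_fderiv hV y h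
    _ = ENNReal.ofReal ‖h‖ * ∫⁻ t in Set.Ioc (0 : ℝ) 1, ∫⁻ y in ball x r,
          ∑ i, ‖fderiv ℝ V (y + t • h) (stdVec i)‖ₑ := by
        rw [lintegral_const_mul' _ _ (by simp), lintegral_lintegral_swap hm.aemeasurable]
    _ ≤ ENNReal.ofReal ‖h‖ * ∫⁻ t in Set.Ioc (0 : ℝ) 1,
          ∑ i, ∫⁻ y in ball x (r + ‖h‖), ‖fderiv ℝ V y (stdVec i)‖ₑ := by
        gcongr ENNReal.ofReal ‖h‖ * ?_
        refine setLIntegral_mono' measurableSet_Ioc fun t ht => ?_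
        have hm' : ∀ i, Measurable fun y : Euc n => ‖fderiv ℝ V (y + t • h) (stdVec i)‖ₑ := fun i =>
          ((hc i).comp (continuous_id.add continuous_const)).enorm.measurable
        rw [lintegral_finsetSum _ fun i _ => hm' i]
        refine Finset.sum_le_sum fun i _ => ?_
        refine lintegral_ball_comp_add_le (fun y => ‖fderiv ℝ V y (stdVec i)‖ₑ) x (t • h) ?_
        rw [norm_smul, Real.norm_of_nonneg ht.1.le]
        have := mul_le_mul_of_nonneg_right ht.2 (norm_nonneg h)
        linarith
    _ = _ := by rw [setLIntegral_const]; simp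

open scoped Convolution in
theorem lintegral_ball_mollify_le {n : ℕ} (φ : ContDiffBump (0 : Euc n)) {g : Euc n → ℝ}
    (hg : Measurable g) (x : Euc n) {r R : ℝ} (hR : r + φ.rOut ≤ R) :
    ∫⁻ y in ball x r, ‖(φ.normed volume ⋆[ContinuousLinearMap.lsmul ℝ ℝ, volume] g) y‖ₑ ≤
      ∫⁻ y in ball x R, ‖g y‖ₑ := by
  have hφc : Continuous (φ.normed volume) := (φ.contDiff_normed (n := 0)).continuous
  have hm : Measurable fun p : Euc n × Euc n => ‖φ.normed volume p.2‖ₑ * ‖g (p.1 - p.2)‖ₑ :=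
    (hφc.measurable.comp measurable_snd).enorm.mul
      (hg.comp (measurable_fst.sub measurable_snd)).enorm
  calc _ ≤ ∫⁻ y in ball x r, ∫⁻ t, ‖φ.normed volume t‖ₑ * ‖g (y - t)‖ₑ := by
        gcongr with y
        rw [MeasureTheory.convolution_def]
        refine (enorm_integral_le_lintegral_enorm _).trans (le_of_eq ?_)
        simp [enorm_mul]
    _ = ∫⁻ t, ∫⁻ y in ball x r, ‖φ.normed volume t‖ₑ * ‖g (y - t)‖ₑ :=
        lintegral_lintegral_swap hm.aemeasurable
    _ ≤ ∫⁻ t, ‖φ.normed volume t‖ₑ * ∫⁻ y in ball x R, ‖g y‖ₑ := by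
        refine lintegral_mono fun t => ?_
        rw [lintegral_const_mul' _ _ (by simp)]
        by_cases ht : t ∈ ball (0 : Euc n) φ.rOut
        · have h1 := lintegral_ball_comp_add_le (fun y => ‖g y‖ₑ) x (-t) (r := r) (R := R)
          simp only [← sub_eq_add_neg, norm_neg] at h1
          refine mul_le_mul_right (h1 ?_) _
          rw [mem_ball_zero_iff] at ht
          linarith
        · rw [← φ.support_normed_eq (μ := volume), Function.notMem_support] at ht
          simp [ht]
    _ = (∫⁻ t, ‖φ.normed volume t‖ₑ) * ∫⁻ y in ball x R, ‖g y‖ₑ :=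
        lintegral_mul_const _ hφc.enorm.measurable
    _ = _ := by
        have h1 : ∫⁻ t, ‖φ.normed volume t‖ₑ = ENNReal.ofReal (∫ t, φ.normed volume t) := by
          rw [ofReal_integral_eq_lintegral_ofReal φ.integrable_normed
            (Eventually.of_forall φ.nonneg_normed)]
          refine lintegral_congr fun t => ?_
          rw [Real.enorm_eq_ofReal (φ.nonneg_normed t)]
        rw [h1, φ.integral_normed]
        simp

open scoped Convolution in
theorem fderiv_mollify {n : ℕ} (φ : ContDiffBump (0 : Euc n)) {v g : Euc n → ℝ}
    (hv : LocallyIntegrable v volume) {i : Fin n} (h : IsWeakPartial i v g) (x : Euc n) :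
    ContDiff ℝ 1 (φ.normed volume ⋆[ContinuousLinearMap.lsmul ℝ ℝ, volume] v) ∧
    fderiv ℝ (φ.normed volume ⋆[ContinuousLinearMap.lsmul ℝ ℝ, volume] v) x (stdVec i) =
      (φ.normed volume ⋆[ContinuousLinearMap.lsmul ℝ ℝ, volume] g) x := by
  set ψ := φ.normed volume with hψ
  have hcs : HasCompactSupport ψ := φ.hasCompactSupport_normed
  have hsm : ContDiff ℝ (⊤ : ℕ∞) ψ := φ.contDiff_normed
  have hsm1 : ContDiff ℝ 1 ψ := φ.contDiff_normed
  refine ⟨hcs.contDiff_convolution_left _ hsm1 hv, ?_⟩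
  rw [← convolution_flip]
  rw [(hcs.hasFDerivAt_convolution_right (ContinuousLinearMap.lsmul ℝ ℝ).flip hv hsm1 x).fderiv,
    convolution_precompR_apply _ hv (hcs.fderiv ℝ) (hsm1.continuous_fderiv (by norm_num))]
  have hrefl : ∀ t : Euc n, fderiv ℝ (fun t => ψ (x - t)) t (stdVec i) =
      -fderiv ℝ ψ (x - t) (stdVec i) := by
    intro t
    have h1 : HasFDerivAt (fun t : Euc n => x - t) (-ContinuousLinearMap.id ℝ (Euc n)) t :=
      (hasFDerivAt_id t).const_sub x
    have h2 := ((hsm1.differentiable (by norm_num)) (x - t)).hasFDerivAt.comp t h1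
    have h3 : fderiv ℝ (fun t => ψ (x - t)) t = _ := h2.fderiv
    rw [h3]
    simp
  have h4 := h (fun t => ψ (x - t)) (hsm.comp (contDiff_const.sub contDiff_id))
    (hcs.comp_homeomorph (Homeomorph.subLeft x))
  simp_rw [hrefl, mul_neg, integral_neg, neg_inj] at h4
  rw [MeasureTheory.convolution_def, convolution_eq_swap]
  simp only [ContinuousLinearMap.flip_apply, ContinuousLinearMap.lsmul_apply, smul_eq_mul]
  simp_rw [mul_comm _ (v _), h4, mul_comm (g _)]

open scoped Convolution in
theorem lintegral_translate_sub_le_of_isWeakPartial {n : ℕ} {v : Euc n → ℝ}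
    {g : Fin n → Euc n → ℝ} (hv : LocallyIntegrable v volume)
    (hg : ∀ i, Measurable (g i)) (h : ∀ i, IsWeakPartial i v (g i)) (x a : Euc n) {r R : ℝ}
    (hR : r + ‖a‖ < R) :
    ∫⁻ y in ball x r, ‖v (y + a) - v y‖ₑ ≤
      ENNReal.ofReal ‖a‖ * ∑ i, ∫⁻ y in ball x R, ‖g i y‖ₑ := by
  set ε : ℝ := R - (r + ‖a‖) with hε
  have hε0 : 0 < ε := by linarith
  let φ : ℕ → ContDiffBump (0 : Euc n) := fun k =>
    { rIn := ε / (k + 2) / 2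
      rOut := ε / (k + 2)
      rIn_pos := by positivity
      rIn_lt_rOut := half_lt_self (by positivity) }
  have hlim : Tendsto (fun k => (φ k).rOut) atTop (𝓝 0) := by
    have h1 : Tendsto (fun k : ℕ => (k : ℝ) + 2) atTop atTop :=
      tendsto_atTop_add_const_right _ _ tendsto_natCast_atTop_atTop
    exact h1.const_div_atTop ε
  have hae := ContDiffBump.ae_convolution_tendsto_right_of_locallyIntegrable (μ := volume)
    (φ := φ) (K := 2) hlim (Eventually.of_forall fun k => by simp only [φ]; linarith) hv
  have hae' : ∀ᵐ y, Tendsto (fun k =>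
      ((φ k).normed volume ⋆[ContinuousLinearMap.lsmul ℝ ℝ, volume] v) (y + a)) atTop
      (𝓝 (v (y + a))) :=
    (measurePreserving_add_right volume a).quasiMeasurePreserving.ae hae
  set V : ℕ → Euc n → ℝ := fun k => (φ k).normed volume ⋆[ContinuousLinearMap.lsmul ℝ ℝ, volume] v
    with hV
  rcases isEmpty_or_nonempty (Fin n) with hemp | ⟨⟨i₀⟩⟩
  · have : Subsingleton (Euc n) := by
      refine ⟨fun a b => ?_⟩
      ext i
      exact hemp.elim i
    have ha : a = 0 := Subsingleton.elim _ _
    simp [ha]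
  have hV1 : ∀ k, ContDiff ℝ 1 (V k) := fun k => (fderiv_mollify (φ k) hv (h i₀) 0).1
  have hbound : ∀ k, ∫⁻ y in ball x r, ‖V k (y + a) - V k y‖ₑ ≤
      ENNReal.ofReal ‖a‖ * ∑ i, ∫⁻ y in ball x R, ‖g i y‖ₑ := by
    intro k
    refine (lintegral_translate_sub_le (hV1 k) x a r).trans ?_
    refine mul_le_mul_right (Finset.sum_le_sum fun i _ => ?_) _
    calc _ = ∫⁻ y in ball x (r + ‖a‖),
          ‖((φ k).normed volume ⋆[ContinuousLinearMap.lsmul ℝ ℝ, volume] (g i)) y‖ₑ := by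
          refine lintegral_congr fun y => ?_
          rw [(fderiv_mollify (φ k) hv (h i) y).2]
      _ ≤ _ := by
          refine lintegral_ball_mollify_le (φ k) (hg i) x ?_
          have : (φ k).rOut ≤ ε := div_le_self hε0.le (by linarith [Nat.cast_nonneg (α := ℝ) k])
          linarith
  calc ∫⁻ y in ball x r, ‖v (y + a) - v y‖ₑ
      ≤ ∫⁻ y in ball x r, liminf (fun k => ‖V k (y + a) - V k y‖ₑ) atTop := by
        refine lintegral_mono_ae (ae_restrict_of_ae ?_)
        filter_upwards [hae, hae'] with y h1 h2
        exact ((h2.sub h1).enorm.liminf_eq).ge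
    _ ≤ liminf (fun k => ∫⁻ y in ball x r, ‖V k (y + a) - V k y‖ₑ) atTop := by
        refine lintegral_liminf_le fun k => ?_
        exact (((hV1 k).continuous.comp (continuous_id.add continuous_const)).sub
          (hV1 k).continuous).enorm.measurable
    _ ≤ _ := by
        refine (liminf_le_liminf (Eventually.of_forall hbound)).trans (by simp)

/-- Poincaré inequality on balls, in double-integral form. -/
theorem oscInt_ball_le_of_isWeakPartial {n : ℕ} {v : Euc n → ℝ}
    {g : Fin n → Euc n → ℝ} (hvm : Measurable v) (hv : LocallyIntegrable v volume)
    (hg : ∀ i, Measurable (g i)) (h : ∀ i, IsWeakPartial i v (g i)) (x : Euc n) {r : ℝ}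
    (hr : 0 < r) :
    oscInt v (ball x r) (ball x r) ≤ volume (ball (0 : Euc n) (2 * r)) *
      (ENNReal.ofReal (2 * r) * ∑ i, ∫⁻ y in ball x (4 * r), ‖g i y‖ₑ) := by
  have hm : Measurable fun p : Euc n × Euc n => ‖v (p.1 + p.2) - v p.1‖ₑ :=
    ((hvm.comp (measurable_fst.add measurable_snd)).sub (hvm.comp measurable_fst)).enorm
  calc oscInt v (ball x r) (ball x r)
      ≤ ∫⁻ y in ball x r, ∫⁻ a in ball (0 : Euc n) (2 * r), ‖v (y + a) - v y‖ₑ := by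
        refine setLIntegral_mono' measurableSet_ball fun y hy => ?_
        rw [← lintegral_indicator measurableSet_ball, ← lintegral_indicator measurableSet_ball,
          ← lintegral_add_left_eq_self _ y]
        refine lintegral_mono fun a => ?_
        by_cases ha : y + a ∈ ball x r
        · have : a ∈ ball (0 : Euc n) (2 * r) := by
            rw [mem_ball_zero_iff]
            rw [mem_ball, dist_eq_norm] at ha hy
            calc ‖a‖ = ‖(y + a - x) - (y - x)‖ := by congr 1; abel
              _ ≤ ‖y + a - x‖ + ‖y - x‖ := norm_sub_le _ _
              _ < _ := by linarith
          simp only [indicator_of_mem ha, indicator_of_mem this]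
          rw [← enorm_neg, neg_sub]
        · simp [ha]
    _ = ∫⁻ a in ball (0 : Euc n) (2 * r), ∫⁻ y in ball x r, ‖v (y + a) - v y‖ₑ :=
        lintegral_lintegral_swap hm.aemeasurable
    _ ≤ ∫⁻ a in ball (0 : Euc n) (2 * r),
          (ENNReal.ofReal (2 * r) * ∑ i, ∫⁻ y in ball x (4 * r), ‖g i y‖ₑ) := by
        refine setLIntegral_mono' measurableSet_ball fun a ha => ?_
        rw [mem_ball_zero_iff] at ha
        refine (lintegral_translate_sub_le_of_isWeakPartial hv hg h x a (r := r) (R := 4 * r)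
          (by linarith)).trans ?_
        gcongr
    _ = _ := by rw [setLIntegral_const, mul_comm]

/-! ### From the top-order gradient to mean oscillation -/

theorem iteratedFDeriv_fderiv_apply {n : ℕ} {φ : Euc n → ℝ} (hφ : ContDiff ℝ (⊤ : ℕ∞) φ) (h : ℕ)
    (x w : Euc n) (d : Fin h → Euc n) :
    iteratedFDeriv ℝ h (fun y => fderiv ℝ φ y w) x d =
      iteratedFDeriv ℝ (h + 1) φ x (Fin.snoc d w) := by
  rw [iteratedFDeriv_succ_apply_right]
  simp only [Fin.init_snoc, Fin.snoc_last]
  have hd : ContDiff ℝ (⊤ : ℕ∞) (fderiv ℝ φ) := hφ.fderiv_right (by simp)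
  have h1 := (ContinuousLinearMap.apply ℝ ℝ w).iteratedFDeriv_comp_left (f := fderiv ℝ φ)
    (hd.contDiffAt (x := x)) (i := h) (by exact_mod_cast le_top)
  have h2 : (fun y => fderiv ℝ φ y w) = (ContinuousLinearMap.apply ℝ ℝ w) ∘ fderiv ℝ φ := rfl
  rw [h2, h1]
  rfl

theorem stdVec_snoc {n h : ℕ} (d : Fin h → Fin n) (i : Fin n) :
    (fun j => stdVec ((Fin.snoc d i : Fin (h + 1) → Fin n) j)) =
      (Fin.snoc (fun j => stdVec (d j)) (stdVec i) : Fin (h + 1) → Euc n) := by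
  funext j
  refine Fin.lastCases ?_ (fun j => ?_) j <;> simp

theorem HasWeakDerivs.isWeakPartial {n m : ℕ} {u : Euc n → ℝ}
    {D : (h : ℕ) → Euc n → (Fin h → Fin n) → ℝ} (hD : HasWeakDerivs n m u D) {h : ℕ} (hh : h < m)
    (d : Fin h → Fin n) (i : Fin n) :
    IsWeakPartial i (fun x => D h x d) (fun x => D (h + 1) x (Fin.snoc d i)) := by
  intro φ hφ hcs
  have hψ : ContDiff ℝ (⊤ : ℕ∞) fun y => fderiv ℝ φ y (stdVec i) :=
    (hφ.fderiv_right (m := (⊤ : ℕ∞)) (by simp)).clm_apply contDiff_const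
  have h1 := (hD.2 h hh.le d).2 _ hψ (hcs.fderiv_apply ℝ (stdVec i))
  have h2 := (hD.2 (h + 1) hh (Fin.snoc d i)).2 φ hφ hcs
  have h3 : ∀ x, iteratedFDeriv ℝ h (fun y => fderiv ℝ φ y (stdVec i)) x
      (fun j => EuclideanSpace.single (d j) (1 : ℝ)) = iteratedFDeriv ℝ (h + 1) φ x
      (fun j => EuclideanSpace.single ((Fin.snoc d i : Fin (h + 1) → Fin n) j) (1 : ℝ)) := by
    intro x
    rw [iteratedFDeriv_fderiv_apply hφ, ← stdVec_snoc]
  simp_rw [h3] at h1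
  rw [h2] at h1
  have hsign : ((-1 : ℝ) ^ h) * (-1) ^ h = 1 := by
    rw [← mul_pow]; norm_num
  calc ∫ x, D h x d * fderiv ℝ φ x (stdVec i)
      = ((-1 : ℝ) ^ h * (-1) ^ h) * ∫ x, D h x d * fderiv ℝ φ x (stdVec i) := by
        rw [hsign, one_mul]
    _ = (-1 : ℝ) ^ h * ((-1 : ℝ) ^ (h + 1) * ∫ x, D (h + 1) x (Fin.snoc d i) * φ x) := by
        rw [h1, mul_assoc]
    _ = ((-1 : ℝ) ^ h * (-1) ^ h) * -∫ x, D (h + 1) x (Fin.snoc d i) * φ x := by ring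
    _ = _ := by rw [hsign, one_mul]

theorem IsWeakPartial.congr {n : ℕ} {i : Fin n} {v g v' g' : Euc n → ℝ} (h : IsWeakPartial i v g)
    (hv : v =ᵐ[volume] v') (hg : g =ᵐ[volume] g') : IsWeakPartial i v' g' := by
  intro φ hφ hcs
  have h1 := h φ hφ hcs
  rw [integral_congr_ae (g := fun x => v' x * fderiv ℝ φ x (stdVec i))
      (hv.mono fun x hx => by simp only [hx]),
    integral_congr_ae (f := fun x => g x * φ x) (g := fun x => g' x * φ x)
      (hg.mono fun x hx => by simp only [hx])] at h1
  exact h1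

theorem oscInt_congr {n : ℕ} {f g : Euc n → ℝ} (h : f =ᵐ[volume] g) (S T : Set (Euc n)) :
    oscInt f S T = oscInt g S T := by
  refine lintegral_congr_ae (ae_restrict_of_ae (h.mono fun y hy => ?_))
  refine lintegral_congr_ae (ae_restrict_of_ae (h.mono fun z hz => ?_))
  simp only [hy, hz]

/-- One step down the chain of derivatives. -/
theorem oscInt_le_of_partials {n h : ℕ} (hn : 0 < n) {v : Euc n → ℝ} {g : Fin n → Euc n → ℝ}
    (hvm : Measurable v) (hv : LocallyIntegrable v volume) (hg : ∀ i, Measurable (g i))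
    (hw : ∀ i, IsWeakPartial i v (g i))
    (hdecay : ∀ i t, 0 < t → volume {x | t < |g i x|} < ⊤)
    {Φ : ℝ → ℝ} (hΦ : SlowWeight Φ) {K : ℝ≥0∞}
    (hosc : ∀ (i : Fin n) (x : Euc n) (r : ℝ), 0 < r → oscInt (g i) (ball x r) (ball x r) ≤
      K * volume (ball x r) ^ 2 * ENNReal.ofReal (Φ r / r ^ (h + 1))) (x : Euc n) {r : ℝ}
    (hr : 0 < r) :
    oscInt v (ball x r) (ball x r) ≤
      (16 * n * 16 ^ n) * K * volume (ball x r) ^ 2 * ENNReal.ofReal (Φ r / r ^ h) := by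
  have hΦ0 := (hΦ r hr).1
  have hvol : ∀ (c : ℕ) (y : Euc n), 0 < c →
      volume (ball y (c * r)) = (c : ℝ≥0∞) ^ n * volume (ball x r) := by
    intro c y hc
    have hc' : (0 : ℝ) < c := by exact_mod_cast hc
    rw [volume_ball_eq y (by positivity), volume_ball_eq x hr, mul_pow,
      ENNReal.ofReal_mul (by positivity), ENNReal.ofReal_pow hc'.le, ENNReal.ofReal_natCast,
      mul_assoc]
  have hv2 := hvol 2 0 (by norm_num)
  have hv4 := hvol 4 x (by norm_num)
  push_cast at hv2 hv4
  have hΦ4 : Φ (4 * r) / (4 * r) ^ (h + 1) ≤ Φ r / r ^ (h + 1) := by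
    have h1 := hΦ.pow hr 2
    norm_num at h1
    have h2 : (4 : ℝ) ≤ 4 ^ (h + 1) := le_self_pow₀ (by norm_num) (by omega)
    rw [mul_pow, ← div_div]
    gcongr
    rw [div_le_iff₀ (by positivity)]
    nlinarith
  refine (oscInt_ball_le_of_isWeakPartial hvm hv hg hw x hr).trans ?_
  calc _ ≤ volume (ball (0 : Euc n) (2 * r)) * (ENNReal.ofReal (2 * r) *
        ∑ i : Fin n, 8 * 2 ^ n * K * volume (ball x (4 * r)) *
          ENNReal.ofReal (Φ r / r ^ (h + 1))) := by
        gcongr with i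
        refine (lintegral_ball_le_of_oscInt hn (Nat.le_add_left 1 h) (hg i) (hdecay i) hΦ (hosc i)
          x (by positivity)).trans ?_
        gcongr
    _ = (16 * n * 16 ^ n) * K * volume (ball x r) ^ 2 *
          (ENNReal.ofReal r * ENNReal.ofReal (Φ r / r ^ (h + 1))) := by
        rw [Finset.sum_const, Finset.card_univ, Fintype.card_fin, nsmul_eq_mul, hv2, hv4,
          ENNReal.ofReal_mul (by norm_num), show ENNReal.ofReal 2 = 2 by simp,
          show (16 : ℝ≥0∞) ^ n = 2 ^ n * 2 ^ n * 4 ^ n by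
            rw [← mul_pow, ← mul_pow]; norm_num]
        ring
    _ = _ := by
        rw [← ENNReal.ofReal_mul hr.le]
        congr 2
        field_simp
        ring

theorem oscInt_le_of_weakDerivs {n m : ℕ} (hn : 0 < n) {u : Euc n → ℝ}
    {D : (h : ℕ) → Euc n → (Fin h → Fin n) → ℝ} (hD : HasWeakDerivs n m u D)
    (hdecay : DecayFrom n 1 m D) {Φ : ℝ → ℝ} (hΦ : SlowWeight Φ) {K : ℝ≥0∞}
    (hosc : ∀ (d : Fin m → Fin n) (x : Euc n) (r : ℝ), 0 < r →
      oscInt (fun x => D m x d) (ball x r) (ball x r) ≤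
      K * volume (ball x r) ^ 2 * ENNReal.ofReal (Φ r / r ^ m)) (x : Euc n) {r : ℝ} (hr : 0 < r) :
    oscInt u (ball x r) (ball x r) ≤
      (16 * n * 16 ^ n) ^ m * K * volume (ball x r) ^ 2 * ENNReal.ofReal (Φ r) := by
  have hae : ∀ h, h ≤ m → ∀ d : Fin h → Fin n, AEMeasurable (fun x => D h x d) volume :=
    fun h hh d => (hD.2 h hh d).1.aestronglyMeasurable.aemeasurable
  have hdec : ∀ h, 1 ≤ h → (hh : h ≤ m) → ∀ d : Fin h → Fin n, ∀ t, 0 < t →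
      volume {x | t < |(hae h hh d).mk _ x|} < ⊤ := by
    intro h h1 hh d t ht
    refine lt_of_le_of_lt (measure_mono_ae ?_) (hdecay h h1 hh t ht)
    filter_upwards [(hae h hh d).ae_eq_mk] with x hx
    intro (hlt : t < |(hae h hh d).mk _ x|)
    rw [← hx] at hlt
    refine lt_of_lt_of_le hlt ?_
    rw [gradLen, ← Real.sqrt_sq_eq_abs]
    exact Real.sqrt_le_sqrt (Finset.single_le_sum (f := fun d => D h x d ^ 2)
      (fun d _ => sq_nonneg _) (Finset.mem_univ d))
  have key : ∀ j h : ℕ, h + j = m → ∀ (d : Fin h → Fin n) (x : Euc n) (r : ℝ), 0 < r →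
      oscInt (fun x => D h x d) (ball x r) (ball x r) ≤
      (16 * n * 16 ^ n) ^ j * K * volume (ball x r) ^ 2 * ENNReal.ofReal (Φ r / r ^ h) := by
    intro j
    induction j with
    | zero =>
      rintro h rfl d x r hr
      simpa using hosc d x r hr
    | succ j ih =>
      intro h hj d x r hr
      have hh : h ≤ m := by omega
      have hh1 : h + 1 ≤ m := by omega
      have e1 := (hae h hh d).ae_eq_mk
      have e2 := fun i => (hae (h + 1) hh1 (Fin.snoc d i)).ae_eq_mk
      have hint : LocallyIntegrable ((hae h hh d).mk _) volume := by
        intro x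
        obtain ⟨U, hU, hi⟩ := (hD.2 h hh d).1 x
        exact ⟨U, hU, hi.congr_fun_ae (ae_restrict_of_ae e1)⟩
      rw [oscInt_congr e1]
      have := oscInt_le_of_partials hn (K := (16 * n * 16 ^ n) ^ j * K)
        (g := fun i => (hae (h + 1) hh1 (Fin.snoc d i)).mk _)
        (hae h hh d).measurable_mk hint (fun i => AEMeasurable.measurable_mk _)
        (fun i => (hD.isWeakPartial (by omega) d i).congr e1 (e2 i))
        (fun i t ht => hdec (h + 1) (by omega) hh1 _ t ht) hΦ
        (fun i x r hr => by
          rw [← oscInt_congr (e2 i)]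
          exact ih (h + 1) (by omega) (Fin.snoc d i) x r hr) x hr
      refine this.trans (le_of_eq ?_)
      ring
  have h0 := key m 0 (by omega) Fin.elim0 x r hr
  have hu : (fun x => D 0 x Fin.elim0) = u := funext fun x => hD.1 x _
  rw [hu] at h0
  simpa using h0

theorem ofReal_oscQuot_le {n : ℕ} {u : Euc n → ℝ} (hu : LocallyIntegrable u volume) (x : Euc n)
    {r : ℝ} (hr : 0 < r) :
    ENNReal.ofReal (oscQuot n (fun _ => 1) u x r) * volume (ball x r) ^ 2 ≤
      oscInt u (ball x r) (ball x r) := by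
  obtain ⟨hB0, hBt⟩ := volume_ball_pos_ne x hr
  have hint : IntegrableOn u (ball x r) volume :=
    (hu.integrableOn_isCompact (isCompact_closedBall x r)).mono_set ball_subset_closedBall
  have hreal : volume.real (ball x r) ≠ 0 := (ENNReal.toReal_pos hB0 hBt).ne'
  set c := ⨍ z in ball x r, u z with hc
  have hpt : ∀ y, ‖u y - c‖ₑ * volume (ball x r) ≤ ∫⁻ z in ball x r, ‖u y - u z‖ₑ := by
    intro y
    have h1 : (u y - c) * volume.real (ball x r) = ∫ z in ball x r, (u y - u z) := by
      have hci : IntegrableOn (fun _ : Euc n => u y) (ball x r) volume :=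
        integrableOn_const hBt
      rw [integral_sub hci hint, setIntegral_const, hc, setAverage_eq]
      simp only [smul_eq_mul]
      field_simp
    have h2 : ‖(u y - c) * volume.real (ball x r)‖ₑ = ‖u y - c‖ₑ * volume (ball x r) := by
      rw [enorm_mul, Real.enorm_of_nonneg measureReal_nonneg, Measure.real,
        ENNReal.ofReal_toReal hBt]
    rw [← h2, h1]
    exact enorm_integral_le_lintegral_enorm _
  have hosc : ENNReal.ofReal (oscQuot n (fun _ => 1) u x r) * volume (ball x r) =
      ∫⁻ y in ball x r, ‖u y - c‖ₑ := by
    have hci : IntegrableOn (fun y => u y - c) (ball x r) volume :=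
      hint.sub (integrableOn_const hBt)
    have h3 : oscQuot n (fun _ => 1) u x r * volume.real (ball x r) =
        ∫ y in ball x r, |u y - c| := by
      rw [oscQuot, setAverage_eq]
      simp only [smul_eq_mul, inv_one, one_mul]
      rw [← hc]
      field_simp
    rw [← ENNReal.ofReal_toReal hBt, ← ENNReal.ofReal_mul' ENNReal.toReal_nonneg]
    change ENNReal.ofReal (_ * volume.real (ball x r)) = _
    rw [h3, ← ofReal_integral_norm_eq_lintegral_enorm hci]
    rfl
  rw [pow_two, ← mul_assoc, hosc, oscInt, ← lintegral_mul_const' _ _ hBt]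
  exact lintegral_mono fun y => hpt y

theorem oscInt_component_le {n m : ℕ} {s : ℝ} (hsm : m < s) (hsm1 : s < m + 1)
    {A : ℝ → ℝ≥0∞} {v : Euc n → (Fin m → Fin n) → ℝ} {lam δ a b : ℝ}
    (hlam : 0 < lam) (hδ : 0 < δ) (ha : 0 ≤ a) (hb : 0 ≤ b)
    (hJ : Jfun n (s - m) A (fun x i => v x i / lam) ≤ 1) (hconj : ConjBound A n s δ a b)
    (d : Fin m → Fin n) (x : Euc n) {r : ℝ} (hr : 0 < r) :
    oscInt (fun x => v x d) (ball x r) (ball x r) ≤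
      ENNReal.ofReal (2 * lam * δ) * (2 ^ n * (volume (ball (0 : Euc n) 1) ^ 2)⁻¹ + 1) *
        volume (ball x r) ^ 2 * ENNReal.ofReal ((1 + a + b * √r) / r ^ m) := by
  set σ := s - m with hσ
  have hσ0 : 0 < σ := by linarith
  have hσ1 : σ < 1 := by linarith
  set w : Euc n → Euc n → ℝ := fun y z =>
    √(∑ i, (v y i / lam - v z i / lam) ^ 2) / ‖y - z‖ ^ σ with hw
  set F : Euc n → Euc n → ℝ≥0∞ := fun y z => A (w y z) / ENNReal.ofReal (‖y - z‖ ^ (n : ℝ)) with hF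
  have hpt : ∀ y ∈ ball x r, ∀ z ∈ ball x r, ‖v y d - v z d‖ₑ ≤
      ENNReal.ofReal (2 * lam * δ / r ^ m) * (ENNReal.ofReal (r ^ n * (2 * r) ^ n) * F y z +
        ENNReal.ofReal (a + b * √r)) := by
    intro y hy z hz
    rcases eq_or_ne y z with rfl | hne
    · simp
    have hN : 0 < ‖y - z‖ := norm_pos_iff.2 (sub_ne_zero.2 hne)
    have hN2 : ‖y - z‖ ≤ 2 * r := by
      rw [mem_ball, dist_eq_norm] at hy hz
      calc ‖y - z‖ = ‖(y - x) - (z - x)‖ := by congr 1; abel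
        _ ≤ ‖y - x‖ + ‖z - x‖ := norm_sub_le _ _
        _ ≤ _ := by linarith
    have hw0 : 0 ≤ w y z := by positivity
    have h1 : |v y d - v z d| ≤ 2 * lam / r ^ m * (w y z * r ^ s) := by
      have h2 : |v y d / lam - v z d / lam| ≤ √(∑ i, (v y i / lam - v z i / lam) ^ 2) := by
        rw [← Real.sqrt_sq_eq_abs]
        exact Real.sqrt_le_sqrt (Finset.single_le_sum
          (f := fun d => (v y d / lam - v z d / lam) ^ 2) (fun d _ => sq_nonneg _)
          (Finset.mem_univ d))
      have h3 : √(∑ i, (v y i / lam - v z i / lam) ^ 2) = w y z * ‖y - z‖ ^ σ := by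
        simp only [hw]
        rw [div_mul_cancel₀]
        positivity
      have h4 : ‖y - z‖ ^ σ ≤ 2 * r ^ σ := by
        calc ‖y - z‖ ^ σ ≤ (2 * r) ^ σ := by gcongr
          _ = 2 ^ σ * r ^ σ := Real.mul_rpow (by norm_num) hr.le
          _ ≤ 2 ^ (1 : ℝ) * r ^ σ := by gcongr; norm_num
          _ = _ := by rw [Real.rpow_one]
      have h5 : r ^ s = r ^ σ * r ^ m := by
        rw [← Real.rpow_natCast, ← Real.rpow_add hr]; congr 1; rw [hσ]; ring
      calc |v y d - v z d| = lam * |v y d / lam - v z d / lam| := by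
            rw [← sub_div, abs_div, abs_of_pos hlam]; field_simp
        _ ≤ lam * (w y z * (2 * r ^ σ)) := by
            rw [h3] at h2
            gcongr
            exact h2.trans (by gcongr)
        _ = _ := by rw [h5]; field_simp
    have h6 : ENNReal.ofReal (w y z * r ^ s) ≤
        ENNReal.ofReal δ * (ENNReal.ofReal (r ^ n) * A (w y z) + ENNReal.ofReal (a + b * √r)) := by
      have h7 : w y z * r ^ s = δ * (r ^ n * (w y z * (r ^ (s - n) / δ))) := by
        rw [Real.rpow_sub hr, Real.rpow_natCast]; field_simp
      rw [h7, ENNReal.ofReal_mul hδ.le, ENNReal.ofReal_mul (by positivity)]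
      gcongr
      calc _ ≤ ENNReal.ofReal (r ^ n) * (A (w y z) + youngConj A (r ^ (s - n) / δ)) := by
            gcongr
            exact ofReal_mul_le_add_youngConj A hw0 _
        _ ≤ _ := by
            rw [mul_add]
            gcongr
            exact hconj r hr
    have h8 : A (w y z) ≤ ENNReal.ofReal ((2 * r) ^ n) * F y z := by
      have hp : 0 < ‖y - z‖ ^ (n : ℝ) := by positivity
      calc A (w y z) = ENNReal.ofReal (‖y - z‖ ^ (n : ℝ)) * F y z := by
            rw [hF]
            exact (ENNReal.mul_div_cancel (ENNReal.ofReal_pos.2 hp).ne' ENNReal.ofReal_ne_top).symm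
        _ ≤ _ := by
            gcongr
            rw [Real.rpow_natCast]
            gcongr
    calc ‖v y d - v z d‖ₑ ≤ ENNReal.ofReal (2 * lam / r ^ m * (w y z * r ^ s)) := by
          rw [Real.enorm_eq_ofReal_abs]
          exact ENNReal.ofReal_le_ofReal h1
      _ ≤ ENNReal.ofReal (2 * lam / r ^ m) * (ENNReal.ofReal δ * (ENNReal.ofReal (r ^ n) *
          (ENNReal.ofReal ((2 * r) ^ n) * F y z) + ENNReal.ofReal (a + b * √r))) := by
          rw [ENNReal.ofReal_mul (by positivity)]
          gcongr
          refine h6.trans ?_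
          gcongr
      _ = _ := by
          rw [← mul_assoc, ← ENNReal.ofReal_mul (by positivity),
            ← mul_assoc (ENNReal.ofReal (r ^ n)),
            ← ENNReal.ofReal_mul (by positivity), div_mul_eq_mul_div]
  obtain ⟨hV0, hVt⟩ := volume_ball_pos_ne (0 : Euc n) one_pos
  set c₁ := ENNReal.ofReal (2 * lam * δ / r ^ m) with hc₁
  set c₂ := ENNReal.ofReal (r ^ n * (2 * r) ^ n) with hc₂
  set c₃ := ENNReal.ofReal (a + b * √r) with hc₃
  have hFJ : ∫⁻ y in ball x r, ∫⁻ z in ball x r, F y z ≤ 1 := by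
    refine le_trans ?_ hJ
    exact (lintegral_mono fun _ => setLIntegral_le_lintegral _ _).trans
      (setLIntegral_le_lintegral _ _)
  calc oscInt (fun x => v x d) (ball x r) (ball x r)
      ≤ ∫⁻ y in ball x r, ∫⁻ z in ball x r, c₁ * (c₂ * F y z + c₃) :=
        setLIntegral_mono' measurableSet_ball fun y hy =>
          setLIntegral_mono' measurableSet_ball fun z hz => hpt y hy z hz
    _ = c₁ * (c₂ * (∫⁻ y in ball x r, ∫⁻ z in ball x r, F y z) + c₃ * volume (ball x r) ^ 2) := by
        have h1 : ∀ y, ∫⁻ z in ball x r, c₁ * (c₂ * F y z + c₃) =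
            c₁ * (c₂ * (∫⁻ z in ball x r, F y z) + c₃ * volume (ball x r)) := by
          intro y
          rw [lintegral_const_mul' _ _ ENNReal.ofReal_ne_top,
            lintegral_add_right _ measurable_const,
            lintegral_const_mul' _ _ ENNReal.ofReal_ne_top, setLIntegral_const]
        simp_rw [h1]
        rw [lintegral_const_mul' _ _ ENNReal.ofReal_ne_top, lintegral_add_right _ measurable_const,
            lintegral_const_mul' _ _ ENNReal.ofReal_ne_top, setLIntegral_const]
        ring
    _ ≤ c₁ * (c₂ * 1 + c₃ * volume (ball x r) ^ 2) := by gcongr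
    _ = c₁ * (2 ^ n * (volume (ball (0 : Euc n) 1) ^ 2)⁻¹ * volume (ball x r) ^ 2 +
          c₃ * volume (ball x r) ^ 2) := by
        congr 2
        rw [mul_one, volume_ball_eq x hr, mul_pow, mul_mul_mul_comm,
          ENNReal.inv_mul_cancel (pow_ne_zero 2 hV0) (ENNReal.pow_ne_top hVt), mul_one, hc₂,
          ← ENNReal.ofReal_pow (by positivity), show (2 : ℝ≥0∞) = ENNReal.ofReal 2 by simp,
          ← ENNReal.ofReal_pow (by norm_num), ← ENNReal.ofReal_mul (by positivity)]
        congr 1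
        ring
    _ ≤ c₁ * ((2 ^ n * (volume (ball (0 : Euc n) 1) ^ 2)⁻¹ + 1) * volume (ball x r) ^ 2 *
          ENNReal.ofReal (1 + a + b * √r)) := by
        have h1 : ENNReal.ofReal (1 + a + b * √r) = 1 + c₃ := by
          rw [add_assoc, ENNReal.ofReal_add (by norm_num) (by positivity), ENNReal.ofReal_one]
        rw [h1]
        gcongr
        set p := 2 ^ n * (volume (ball (0 : Euc n) 1) ^ 2)⁻¹
        set q := volume (ball x r) ^ 2
        calc p * q + c₃ * q ≤ p * q + c₃ * q + (p * q * c₃ + q) := le_self_add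
          _ = _ := by ring
    _ = _ := by
        rw [hc₁, div_eq_mul_inv (2 * lam * δ), ENNReal.ofReal_mul (by positivity),
          div_eq_mul_inv (1 + a + b * √r), ENNReal.ofReal_mul (p := 1 + a + b * √r) (by positivity)]
        ring

/-- The oscillation bound behind both the `BMO` estimate and the uniform `VMO` property. -/
theorem exists_ofReal_oscQuot_le {n m : ℕ} (hn : 0 < n) {s : ℝ} (hsm : m < s) (hsm1 : s < m + 1)
    (A : ℝ → ℝ≥0∞) :
    ∃ C : ℝ, 0 < C ∧ ∀ (u : Euc n → ℝ) (D : (h : ℕ) → Euc n → (Fin h → Fin n) → ℝ),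
      HasWeakDerivs n m u D → DecayFrom n 1 m D → ∀ lam δ a b : ℝ, 0 < lam → 0 < δ → 0 ≤ a →
      0 ≤ b → Jfun n (s - m) A (fun x i => D m x i / lam) ≤ 1 → ConjBound A n s δ a b →
      ∀ (x : Euc n) (r : ℝ), 0 < r → ENNReal.ofReal (oscQuot n (fun _ => 1) u x r) ≤
        ENNReal.ofReal (C * (lam * δ * (1 + a + b * √r))) := by
  obtain ⟨hV0, hVt⟩ := volume_ball_pos_ne (0 : Euc n) one_pos
  set C : ℝ≥0∞ := (16 * n * 16 ^ n) ^ m * 2 * (2 ^ n * (volume (ball (0 : Euc n) 1) ^ 2)⁻¹ + 1)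
    with hC
  have hCt : C ≠ ⊤ := by
    have h1 : (volume (ball (0 : Euc n) 1) ^ 2)⁻¹ ≠ ⊤ :=
      ENNReal.inv_ne_top.2 (pow_ne_zero 2 hV0)
    have h2 : (16 * n * 16 ^ n : ℝ≥0∞) ≠ ⊤ := by finiteness
    rw [hC]
    finiteness
  have hC0 : C ≠ 0 := by
    have : (n : ℝ≥0∞) ≠ 0 := by exact_mod_cast hn.ne'
    simp [hC, this]
  refine ⟨C.toReal, ENNReal.toReal_pos hC0 hCt, ?_⟩
  intro u D hD hdecay lam δ a b hlam hδ ha hb hJ hconj x r hr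
  obtain ⟨hB0, hBt⟩ := volume_ball_pos_ne x hr
  have hu : LocallyIntegrable u volume := by
    have := (hD.2 0 (Nat.zero_le _) Fin.elim0).1
    rwa [show (fun x => D 0 x Fin.elim0) = u from funext fun x => hD.1 x _] at this
  have h1 := oscInt_le_of_weakDerivs hn hD hdecay
    (slowWeight_add_sqrt (a := 1 + a) (b := b) (by positivity) hb)
    (fun d x r hr => oscInt_component_le hsm hsm1 hlam hδ ha hb hJ hconj d x hr) x hr
  have h2 := (ofReal_oscQuot_le hu x hr).trans h1
  have h3 : volume (ball x r) ^ 2 * ENNReal.ofReal (oscQuot n (fun _ => 1) u x r) ≤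
      volume (ball x r) ^ 2 * ENNReal.ofReal (C.toReal * (lam * δ * (1 + a + b * √r))) := by
    rw [mul_comm]
    refine h2.trans (le_of_eq ?_)
    have e1 : ENNReal.ofReal (2 * lam * δ) = 2 * ENNReal.ofReal (lam * δ) := by
      rw [mul_assoc, ENNReal.ofReal_mul (by norm_num), ENNReal.ofReal_ofNat]
    have e2 : ENNReal.ofReal (lam * δ * (1 + a + b * √r)) =
        ENNReal.ofReal (lam * δ) * ENNReal.ofReal (1 + a + b * √r) :=
      ENNReal.ofReal_mul (by positivity)
    rw [ENNReal.ofReal_mul ENNReal.toReal_nonneg, ENNReal.ofReal_toReal hCt, e1, e2, hC]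
    ring
  exact (ENNReal.mul_le_mul_iff_right (pow_ne_zero 2 hB0) (ENNReal.pow_ne_top hBt)).1 h3

/-! ### Weak derivatives of test functions -/

theorem contDiff_iteratedFDeriv_apply {n : ℕ} {u : Euc n → ℝ} (hu : ContDiff ℝ (⊤ : ℕ∞) u) {h : ℕ}
    (d : Fin h → Euc n) : ContDiff ℝ (⊤ : ℕ∞) fun x => iteratedFDeriv ℝ h u x d :=
  (ContinuousMultilinearMap.apply ℝ (fun _ : Fin h => Euc n) ℝ d).contDiff.comp
    (hu.iteratedFDeriv_right (m := (⊤ : ℕ∞)) (by exact_mod_cast le_top))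

theorem iteratedFDeriv_succ_eq_fderiv {n : ℕ} {u : Euc n → ℝ} (hu : ContDiff ℝ (⊤ : ℕ∞) u) {h : ℕ}
    (x : Euc n) (d : Fin (h + 1) → Euc n) :
    iteratedFDeriv ℝ (h + 1) u x d =
      fderiv ℝ (fun y => iteratedFDeriv ℝ h u y (Fin.tail d)) x (d 0) := by
  rw [iteratedFDeriv_succ_apply_left]
  have h1 : DifferentiableAt ℝ (iteratedFDeriv ℝ h u) x :=
    (hu.differentiable_iteratedFDeriv (by exact_mod_cast WithTop.coe_lt_top h)) x
  have h2 := ((ContinuousMultilinearMap.apply ℝ (fun _ : Fin h => Euc n) ℝ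
    (Fin.tail d)).hasFDerivAt.comp x h1.hasFDerivAt).fderiv
  have h3 : (fun y => iteratedFDeriv ℝ h u y (Fin.tail d)) =
    (ContinuousMultilinearMap.apply ℝ (fun _ : Fin h => Euc n) ℝ (Fin.tail d)) ∘
      iteratedFDeriv ℝ h u := rfl
  rw [h3, h2]
  rfl

theorem fderiv_fderiv_comm {n : ℕ} {u : Euc n → ℝ} (hu : ContDiff ℝ (⊤ : ℕ∞) u) (x v w : Euc n) :
    fderiv ℝ (fun y => fderiv ℝ u y v) x w = fderiv ℝ (fun y => fderiv ℝ u y w) x v := by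
  have hd : DifferentiableAt ℝ (fderiv ℝ u) x :=
    (hu.fderiv_right (m := (⊤ : ℕ∞)) (by simp)).differentiable (by simp) x
  have hsymm : IsSymmSndFDerivAt ℝ u x :=
    (hu.contDiffAt).isSymmSndFDerivAt (by simpa using WithTop.coe_le_coe.2 (le_top (a := (2 : ℕ∞))))
  rw [fderiv_clm_apply hd (differentiableAt_const v),
    fderiv_clm_apply hd (differentiableAt_const w)]
  simpa using hsymm w v

theorem fderiv_iteratedFDeriv_comm {n h : ℕ} {u : Euc n → ℝ} (hu : ContDiff ℝ (⊤ : ℕ∞) u)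
    (x w : Euc n) (d : Fin h → Euc n) :
    fderiv ℝ (fun y => iteratedFDeriv ℝ h u y d) x w =
      iteratedFDeriv ℝ h (fun y => fderiv ℝ u y w) x d := by
  have hw : ContDiff ℝ (⊤ : ℕ∞) fun y => fderiv ℝ u y w :=
    (hu.fderiv_right (m := (⊤ : ℕ∞)) (by simp)).clm_apply contDiff_const
  induction h generalizing x with
  | zero => simp
  | succ h ih =>
    rw [iteratedFDeriv_succ_eq_fderiv hw]
    simp_rw [← ih _ (Fin.tail d), iteratedFDeriv_succ_eq_fderiv hu]
    exact fderiv_fderiv_comm (contDiff_iteratedFDeriv_apply hu _) x _ _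

theorem integral_mul_iteratedFDeriv {n h : ℕ} {u φ : Euc n → ℝ} (hu : ContDiff ℝ (⊤ : ℕ∞) u)
    (hus : HasCompactSupport u) (hφ : ContDiff ℝ (⊤ : ℕ∞) φ) (d : Fin h → Euc n) :
    ∫ x, u x * iteratedFDeriv ℝ h φ x d = (-1 : ℝ) ^ h * ∫ x, iteratedFDeriv ℝ h u x d * φ x := by
  induction h generalizing u with
  | zero => simp
  | succ h ih =>
    have hw : ContDiff ℝ (⊤ : ℕ∞) fun y => fderiv ℝ u y (d 0) :=
      (hu.fderiv_right (m := (⊤ : ℕ∞)) (by simp)).clm_apply contDiff_const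
    have hG := contDiff_iteratedFDeriv_apply hφ (Fin.tail d)
    have hG' : ContDiff ℝ (⊤ : ℕ∞) fun y =>
        fderiv ℝ (fun y => iteratedFDeriv ℝ h φ y (Fin.tail d)) y (d 0) :=
      (hG.fderiv_right (m := (⊤ : ℕ∞)) (by simp)).clm_apply contDiff_const
    have hws : HasCompactSupport fun y => fderiv ℝ u y (d 0) := hus.fderiv_apply ℝ (d 0)
    simp_rw [iteratedFDeriv_succ_eq_fderiv hφ]
    rw [integral_mul_fderiv_eq_neg_fderiv_mul_of_integrable
      ((hw.continuous.mul hG.continuous).integrable_of_hasCompactSupport hws.mul_right)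
      ((hu.continuous.mul hG'.continuous).integrable_of_hasCompactSupport hus.mul_right)
      ((hu.continuous.mul hG.continuous).integrable_of_hasCompactSupport hus.mul_right)
      (fun x _ => hu.differentiable (by simp) x)
      (fun x _ => hG.differentiable (by simp) x), ih hw hws]
    simp_rw [iteratedFDeriv_succ_eq_fderiv hu, fderiv_iteratedFDeriv_comm hu]
    ring

/-- The classical partial derivatives of `u`, indexed as in `HasWeakDerivs`. -/
noncomputable def classDerivs {n : ℕ} (u : Euc n → ℝ) (h : ℕ) (x : Euc n) (d : Fin h → Fin n) : ℝ :=
  iteratedFDeriv ℝ h u x fun i => stdVec (d i)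

theorem hasWeakDerivs_classDerivs {n : ℕ} (m : ℕ) {u : Euc n → ℝ} (hu : ContDiff ℝ (⊤ : ℕ∞) u)
    (hus : HasCompactSupport u) : HasWeakDerivs n m u (classDerivs u) :=
  ⟨fun x d => by simp [classDerivs], fun h _ d =>
    ⟨(contDiff_iteratedFDeriv_apply hu _).continuous.locallyIntegrable, fun φ hφ _ =>
      integral_mul_iteratedFDeriv hu hus hφ _⟩⟩

theorem decayFrom_classDerivs {n : ℕ} (k m : ℕ) {u : Euc n → ℝ} (hus : HasCompactSupport u) :
    DecayFrom n k m (classDerivs u) := by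
  intro h _ _ t ht
  refine lt_of_le_of_lt (measure_mono fun x (hx : t < _) => ?_)
    (hus.iteratedFDeriv (𝕜 := ℝ) h).isCompact.measure_lt_top
  refine subset_tsupport _ fun h0 => ?_
  simp [gradLen, classDerivs, h0] at hx
  linarith

/-! ### Scaled bumps -/

/-- The fractional difference quotient entering `Jfun`. -/
noncomputable def holderQuot {n : ℕ} {ι : Type} [Fintype ι] (σ : ℝ) (v : Euc n → ι → ℝ)
    (x y : Euc n) : ℝ :=
  √(∑ i, (v x i - v y i) ^ 2) / ‖x - y‖ ^ σ

/-- The radial profile dominating difference quotients of normalized test functions. -/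
noncomputable def fracProfile (n : ℕ) (σ t : ℝ) : ℝ :=
  if t ≤ 1 then t ^ (1 - σ - n) else t ^ (-σ - n)

theorem measurable_fracProfile (n : ℕ) (σ : ℝ) : Measurable (fracProfile n σ) :=
  Measurable.ite measurableSet_Iic (by fun_prop) (by fun_prop)

theorem lintegral_fracProfile_lt_top {n : ℕ} (hn : 0 < n) {σ : ℝ} (hσ0 : 0 < σ) (hσ1 : σ < 1) :
    ∫⁻ y : Euc n, ENNReal.ofReal (fracProfile n σ ‖y‖) < ⊤ := by
  have : Nonempty (Fin n) := ⟨⟨0, hn⟩⟩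
  have hint : Integrable (fun y : Euc n => fracProfile n σ ‖y‖) volume := by
    rw [integrable_fun_norm_addHaar, ← Ioc_union_Ioi_eq_Ioi zero_le_one, finrank_euclideanSpace,
      Fintype.card_fin]
    have hpow : ∀ t : ℝ, 0 < t → ∀ p : ℝ, t ^ (n - 1) * t ^ (p - n) = t ^ (p - 1) := by
      intro t ht p
      rw [← Real.rpow_natCast, ← Real.rpow_add ht, Nat.cast_sub hn]
      congr 1
      push_cast
      ring
    refine IntegrableOn.union ?_ ?_
    · have h1 : IntegrableOn (fun t : ℝ => t ^ (1 - σ - 1)) (Ioc 0 1) :=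
        (intervalIntegrable_iff_integrableOn_Ioc_of_le zero_le_one).1
          (intervalIntegral.intervalIntegrable_rpow' (by linarith))
      refine h1.congr_fun (fun t ht => ?_) measurableSet_Ioc
      simp only [fracProfile, if_pos ht.2, smul_eq_mul]
      rw [hpow t ht.1]
    · have h1 : IntegrableOn (fun t : ℝ => t ^ (-σ - 1)) (Ioi 1) :=
        integrableOn_Ioi_rpow_of_lt (by linarith) one_pos
      refine h1.congr_fun (fun t (ht : 1 < t) => ?_) measurableSet_Ioi
      simp only [fracProfile, if_neg ht.not_ge, smul_eq_mul]
      rw [hpow t (by linarith)]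
  have := hint.lintegral_lt_top
  exact this

theorem lintegral_holderQuot_lt_top {n : ℕ} {ι : Type} [Fintype ι] (hn : 0 < n) {σ : ℝ}
    (hσ0 : 0 < σ) (hσ1 : σ < 1) {v : Euc n → ι → ℝ} {K : Set (Euc n)} (hK : MeasurableSet K)
    (hKt : volume K ≠ ⊤) (hv : ∀ x, x ∉ K → v x = 0)
    (hlip : ∀ x y, √(∑ i, (v x i - v y i) ^ 2) ≤ ‖x - y‖)
    (hbdd : ∀ x y, √(∑ i, (v x i - v y i) ^ 2) ≤ 1) :
    ∫⁻ x : Euc n, ∫⁻ y : Euc n,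
      ENNReal.ofReal (holderQuot σ v x y) / ENNReal.ofReal (‖x - y‖ ^ (n : ℝ)) < ⊤ := by
  set k : Euc n → ℝ≥0∞ := fun z => ENNReal.ofReal (fracProfile n σ ‖z‖) with hk
  have hkm : Measurable k := ((measurable_fracProfile n σ).comp measurable_norm).ennreal_ofReal
  set χ : Euc n → ℝ≥0∞ := K.indicator 1 with hχ
  have hχm : Measurable χ := measurable_one.indicator hK
  have hpt : ∀ x y : Euc n,
      ENNReal.ofReal (holderQuot σ v x y) / ENNReal.ofReal (‖x - y‖ ^ (n : ℝ)) ≤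
      χ x * k (x - y) + χ y * k (x - y) := by
    intro x y
    rcases eq_or_ne x y with rfl | hne
    · simp [holderQuot]
    have hN : 0 < ‖x - y‖ := norm_pos_iff.2 (sub_ne_zero.2 hne)
    by_cases hxy : x ∉ K ∧ y ∉ K
    · simp [holderQuot, hv x hxy.1, hv y hxy.2]
    have h1 : 1 ≤ χ x + χ y := by
      by_cases hx : x ∈ K
      · simp [hχ, hx]
      · have hy : y ∈ K := by_contra fun hy => hxy ⟨hx, hy⟩
        simp [hχ, hy]
    rw [← add_mul]
    refine le_trans ?_ (le_mul_of_one_le_left (zero_le) h1)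
    rw [hk, ← ENNReal.ofReal_div_of_pos (by positivity)]
    refine ENNReal.ofReal_le_ofReal ?_
    rw [holderQuot, fracProfile]
    split_ifs with h
    · rw [Real.rpow_sub hN, Real.rpow_sub hN, Real.rpow_one]
      gcongr
      exact hlip x y
    · rw [Real.rpow_sub hN, Real.rpow_neg hN.le, ← one_div]
      gcongr
      exact hbdd x y
  have hsub : ∀ f : Euc n → ℝ≥0∞, ∀ x, ∫⁻ y, f (x - y) = ∫⁻ y, f y := fun f x =>
    lintegral_sub_left_eq_self f x
  have hI : ∫⁻ z, k z ≠ ⊤ := (lintegral_fracProfile_lt_top hn hσ0 hσ1).ne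
  have hm2 : Measurable fun p : Euc n × Euc n => χ p.2 * k (p.1 - p.2) :=
    (hχm.comp measurable_snd).mul (hkm.comp (measurable_fst.sub measurable_snd))
  have hm1 : Measurable fun p : Euc n × Euc n => χ p.1 * k (p.1 - p.2) :=
    (hχm.comp measurable_fst).mul (hkm.comp (measurable_fst.sub measurable_snd))
  have hχi : ∫⁻ x, χ x = volume K := by rw [hχ, lintegral_indicator_one hK]
  calc _ ≤ ∫⁻ x, ∫⁻ y, (χ x * k (x - y) + χ y * k (x - y)) :=
        lintegral_mono fun x => lintegral_mono fun y => hpt x y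
    _ = (∫⁻ x, ∫⁻ y, χ x * k (x - y)) + ∫⁻ x, ∫⁻ y, χ y * k (x - y) := by
        rw [← lintegral_add_left hm1.lintegral_prod_right']
        refine lintegral_congr fun x => ?_
        exact lintegral_add_left (hm1.comp measurable_prodMk_left) _
    _ = volume K * (∫⁻ z, k z) + volume K * ∫⁻ z, k z := by
        congr 1
        · have : ∀ x, ∫⁻ y, χ x * k (x - y) = χ x * ∫⁻ z, k z := fun x => by
            rw [lintegral_const_mul (χ x) (f := fun y => k (x - y))
              (hkm.comp (measurable_const.sub measurable_id)), hsub]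
          simp_rw [this]
          rw [lintegral_mul_const _ hχm, hχi]
        · rw [lintegral_lintegral_swap hm2.aemeasurable]
          have : ∀ y, ∫⁻ x, χ y * k (x - y) = χ y * ∫⁻ z, k z := fun y => by
            rw [lintegral_const_mul (χ y) (f := fun x => k (x - y))
              (hkm.comp (measurable_id.sub measurable_const)),
              lintegral_sub_right_eq_self k y]
          simp_rw [this]
          rw [lintegral_mul_const _ hχm, hχi]
    _ < ⊤ := by finiteness

theorem lintegral_comp_const_smul {n : ℕ} (f : Euc n → ℝ≥0∞) {R : ℝ} (hR : 0 < R) :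
    ∫⁻ x, f (R⁻¹ • x) = ENNReal.ofReal (R ^ n) * ∫⁻ x, f x := by
  have h0 : R⁻¹ ≠ 0 := inv_ne_zero hR.ne'
  have h1 : ∫⁻ x, f (R⁻¹ • x) = ∫⁻ x, f x ∂(Measure.map (R⁻¹ • ·) (volume : Measure (Euc n))) :=
    (lintegral_map_equiv f (Homeomorph.smulOfNeZero R⁻¹ h0).toMeasurableEquiv).symm
  rw [h1, Measure.map_addHaar_smul _ h0, lintegral_smul_measure, finrank_euclideanSpace,
    Fintype.card_fin, abs_of_pos (by positivity), inv_pow, inv_inv, smul_eq_mul]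

theorem holderQuot_comp_smul {n : ℕ} {ι : Type} [Fintype ι] {σ : ℝ} {v v₀ : Euc n → ι → ℝ}
    {R b : ℝ} (hR : 0 < R) (hb : 0 ≤ b) (hv : ∀ x i, v x i = b * v₀ (R⁻¹ • x) i) (x y : Euc n) :
    holderQuot σ v x y = b * R ^ (-σ) * holderQuot σ v₀ (R⁻¹ • x) (R⁻¹ • y) := by
  have h1 : √(∑ i, (v x i - v y i) ^ 2) =
      b * √(∑ i, (v₀ (R⁻¹ • x) i - v₀ (R⁻¹ • y) i) ^ 2) := by
    nth_rw 1 [← Real.sqrt_sq hb]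
    rw [← Real.sqrt_mul (sq_nonneg b), Finset.mul_sum]
    congr 1
    refine Finset.sum_congr rfl fun i _ => ?_
    rw [hv, hv]
    ring
  rw [holderQuot, holderQuot, h1, ← smul_sub, norm_smul, Real.norm_of_nonneg (by positivity),
    Real.mul_rpow (by positivity) (norm_nonneg _), Real.inv_rpow hR.le, Real.rpow_neg hR.le]
  have : R ^ σ ≠ 0 := (Real.rpow_pos_of_pos hR σ).ne'
  field_simp

theorem Jfun_le_of_comp_smul {n : ℕ} {ι : Type} [Fintype ι] {σ : ℝ} {A : ℝ → ℝ≥0∞}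
    (hA : IsYoung A) {v v₀ : Euc n → ι → ℝ} {R b t : ℝ} (hR : 0 < R) (hb : 0 ≤ b) (ht : 0 ≤ t)
    (hAt : A t ≠ ⊤) (hv : ∀ x i, v x i = b * v₀ (R⁻¹ • x) i) (hbt : b * R ^ (-σ) = t)
    (hle : ∀ x y, holderQuot σ v₀ x y ≤ 1) :
    Jfun n σ A v ≤ A t * ENNReal.ofReal (R ^ n) * ∫⁻ x : Euc n, ∫⁻ y : Euc n,
      ENNReal.ofReal (holderQuot σ v₀ x y) / ENNReal.ofReal (‖x - y‖ ^ (n : ℝ)) := by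
  set G : Euc n → Euc n → ℝ≥0∞ := fun x y =>
    ENNReal.ofReal (holderQuot σ v₀ x y) / ENNReal.ofReal (‖x - y‖ ^ (n : ℝ)) with hG
  set c := ENNReal.ofReal (R ^ n) with hc
  have hc0 : c ≠ 0 := (ENNReal.ofReal_pos.2 (by positivity)).ne'
  have hct : c ≠ ⊤ := ENNReal.ofReal_ne_top
  have hcit : c⁻¹ ≠ ⊤ := ENNReal.inv_ne_top.2 hc0
  have hpt : ∀ x y, A (holderQuot σ v x y) / ENNReal.ofReal (‖x - y‖ ^ (n : ℝ)) ≤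
      A t * c⁻¹ * G (R⁻¹ • x) (R⁻¹ • y) := by
    intro x y
    have h1 : A (holderQuot σ v x y) ≤
        ENNReal.ofReal (holderQuot σ v₀ (R⁻¹ • x) (R⁻¹ • y)) * A t := by
      rw [holderQuot_comp_smul hR hb hv, hbt, mul_comm]
      exact hA.apply_mul_le (by unfold holderQuot; positivity) (hle _ _) ht
    have h2 : ENNReal.ofReal (‖x - y‖ ^ (n : ℝ)) =
        c * ENNReal.ofReal (‖R⁻¹ • x - R⁻¹ • y‖ ^ (n : ℝ)) := by
      rw [hc, ← ENNReal.ofReal_mul (by positivity), ← smul_sub, norm_smul,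
        Real.norm_of_nonneg (by positivity), Real.rpow_natCast, Real.rpow_natCast, mul_pow,
        inv_pow, mul_inv_cancel_left₀ (by positivity)]
    calc _ ≤ ENNReal.ofReal (holderQuot σ v₀ (R⁻¹ • x) (R⁻¹ • y)) * A t /
          (c * ENNReal.ofReal (‖R⁻¹ • x - R⁻¹ • y‖ ^ (n : ℝ))) := by
          rw [h2]; gcongr
      _ = _ := by
          simp only [hG, div_eq_mul_inv]
          rw [ENNReal.mul_inv (Or.inl hc0) (Or.inl hct)]
          ring
  have hAc : A t * c⁻¹ ≠ ⊤ := ENNReal.mul_ne_top hAt hcit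
  calc Jfun n σ A v ≤ ∫⁻ x, ∫⁻ y, A t * c⁻¹ * G (R⁻¹ • x) (R⁻¹ • y) :=
        lintegral_mono fun x => lintegral_mono fun y => hpt x y
    _ = A t * c⁻¹ * (c * (c * ∫⁻ x, ∫⁻ y, G x y)) := by
        have h1 : ∀ x, ∫⁻ y, A t * c⁻¹ * G (R⁻¹ • x) (R⁻¹ • y) =
            A t * c⁻¹ * (c * ∫⁻ y, G (R⁻¹ • x) y) := fun x => by
          rw [lintegral_const_mul' _ _ hAc, lintegral_comp_const_smul (G (R⁻¹ • x)) hR]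
        simp_rw [h1]
        rw [lintegral_const_mul' _ _ hAc, lintegral_const_mul' _ _ hct,
          lintegral_comp_const_smul (fun x => ∫⁻ y, G x y) hR]
    _ = A t * (c⁻¹ * c) * c * ∫⁻ x, ∫⁻ y, G x y := by ring
    _ = _ := by rw [ENNReal.inv_mul_cancel hc0 hct, mul_one]

theorem oscQuot_comp_smul {n : ℕ} (u₀ : Euc n → ℝ) {R α : ℝ} (hR : 0 < R) (hα : 0 ≤ α) :
    oscQuot n (fun _ => 1) (fun x => α * u₀ (R⁻¹ • x)) 0 R = α * oscQuot n (fun _ => 1) u₀ 0 1 := by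
  have havg : ∀ f : Euc n → ℝ, ⨍ x in ball (0 : Euc n) R, f (R⁻¹ • x) =
      ⨍ x in ball (0 : Euc n) 1, f x := by
    intro f
    rw [setAverage_eq, setAverage_eq, Measure.setIntegral_comp_smul_of_pos _ _ _ (inv_pos.2 hR),
      _root_.smul_ball (inv_ne_zero hR.ne'), smul_zero, Real.norm_of_nonneg (by positivity),
      inv_mul_cancel₀ hR.ne', finrank_euclideanSpace, Fintype.card_fin, Measure.real, Measure.real,
      volume_ball_eq 0 hR, ENNReal.toReal_mul, ENNReal.toReal_ofReal (by positivity),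
      inv_pow, inv_inv]
    simp only [smul_eq_mul]
    have : R ^ n ≠ 0 := by positivity
    field_simp
  have h1 : ⨍ x in ball (0 : Euc n) R, α * u₀ (R⁻¹ • x) = α * ⨍ x in ball (0 : Euc n) 1, u₀ x := by
    rw [havg fun x => α * u₀ x, setAverage_eq, setAverage_eq, integral_const_mul]
    simp only [smul_eq_mul]
    ring
  simp only [oscQuot, inv_one, one_mul]
  rw [h1, havg fun x => |α * u₀ x - α * ⨍ x in ball (0 : Euc n) 1, u₀ x|]
  simp_rw [← mul_sub, abs_mul, abs_of_nonneg hα]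
  set c := ⨍ x in ball (0 : Euc n) 1, u₀ x
  rw [setAverage_eq, setAverage_eq, integral_const_mul]
  simp only [smul_eq_mul]
  ring

theorem classDerivs_comp_smul {n h : ℕ} {u : Euc n → ℝ} (hu : ContDiff ℝ (⊤ : ℕ∞) u) (α a : ℝ)
    (x : Euc n) (d : Fin h → Fin n) :
    classDerivs (fun x => α * u (a • x)) h x d = α * a ^ h * classDerivs u h (a • x) d := by
  have hu' : ContDiff ℝ h u := hu.of_le (by exact_mod_cast le_top)
  have h1 : ContDiff ℝ h fun x => u (a • x) := hu'.comp (contDiff_const_smul a)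
  have h2 := iteratedFDeriv_const_smul_apply' (a := α) (h1.contDiffAt (x := x))
  simp only [smul_eq_mul] at h2
  rw [classDerivs, h2, iteratedFDeriv_comp_const_smul a hu']
  simp [classDerivs, mul_assoc]

theorem oscQuot_pos_of_ne {n : ℕ} {u : Euc n → ℝ} (hu : Continuous u) {x a b : Euc n} {r : ℝ}
    (ha : a ∈ ball x r) (hb : b ∈ ball x r) (hab : u a ≠ u b) :
    0 < oscQuot n (fun _ => 1) u x r := by
  have hr : 0 < r := dist_nonneg.trans_lt ha
  obtain ⟨hB0, hBt⟩ := volume_ball_pos_ne x hr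
  simp only [oscQuot, inv_one, one_mul]
  set c := ⨍ z in ball x r, u z
  have hreal : 0 < volume.real (ball x r) := ENNReal.toReal_pos hB0 hBt
  have hc : Continuous fun y => |u y - c| := (hu.sub continuous_const).abs
  have hint : IntegrableOn (fun y => |u y - c|) (ball x r) volume :=
    (hc.locallyIntegrable.integrableOn_isCompact (isCompact_closedBall x r)).mono_set
      ball_subset_closedBall
  rw [setAverage_eq, smul_eq_mul]
  refine mul_pos (inv_pos.2 hreal) (lt_of_le_of_ne (integral_nonneg fun y => abs_nonneg _) ?_)
  intro h0
  have h1 := (integral_eq_zero_iff_of_nonneg (fun y => abs_nonneg _) hint).1 h0.symm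
  have h2 := Measure.eqOn_open_of_ae_eq h1 isOpen_ball hc.continuousOn continuousOn_const
  have h3 : u a - c = 0 := abs_eq_zero.1 (h2 ha)
  have h4 : u b - c = 0 := abs_eq_zero.1 (h2 hb)
  exact hab (by linarith)

theorem exists_profile {n : ℕ} (hn : 0 < n) (m : ℕ) :
    ∃ u : Euc n → ℝ, ContDiff ℝ (⊤ : ℕ∞) u ∧ HasCompactSupport u ∧
      (∀ x y, √(∑ i, (classDerivs u m x i - classDerivs u m y i) ^ 2) ≤ ‖x - y‖) ∧
      (∀ x y, √(∑ i, (classDerivs u m x i - classDerivs u m y i) ^ 2) ≤ 1) ∧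
      0 < oscQuot n (fun _ => 1) u 0 1 := by
  let b : ContDiffBump (0 : Euc n) :=
    { rIn := 1 / 4, rOut := 1 / 2, rIn_pos := by norm_num, rIn_lt_rOut := by norm_num }
  have hb : ContDiff ℝ (⊤ : ℕ∞) b := b.contDiff
  have hbs : HasCompactSupport b := b.hasCompactSupport
  set F : Euc n → EuclideanSpace ℝ (Fin m → Fin n) := fun x =>
    WithLp.toLp 2 (classDerivs b m x) with hF
  have hFc : ContDiff ℝ 1 F := by
    rw [contDiff_euclidean]
    exact fun d => (contDiff_iteratedFDeriv_apply hb _).of_le (by exact_mod_cast le_top)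
  have hFs : HasCompactSupport F := by
    refine (hbs.iteratedFDeriv (𝕜 := ℝ) m).mono fun x hx => ?_
    contrapose! hx
    rw [Function.notMem_support] at hx ⊢
    ext d
    simp [hF, classDerivs, hx]
  obtain ⟨C, hC⟩ := hFc.lipschitzWith_of_hasCompactSupport hFs (by norm_num)
  obtain ⟨M, hM⟩ := hFc.continuous.bounded_above_of_compact_support hFs
  have hM0 : 0 ≤ M := (norm_nonneg _).trans (hM 0)
  set c : ℝ := (C + 2 * M + 1)⁻¹ with hc
  have hc0 : 0 < c := by positivity
  have hcC : c * C ≤ 1 := by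
    rw [hc, inv_mul_le_iff₀ (by positivity)]
    linarith
  have hcM : c * (2 * M) ≤ 1 := by
    rw [hc, inv_mul_le_iff₀ (by positivity)]
    linarith [C.2]
  have hcd : ∀ x d, classDerivs (fun x => c * b x) m x d = c * F x d := by
    intro x d
    simpa [hF] using classDerivs_comp_smul hb c 1 x d
  have hnorm : ∀ x y, √(∑ i, (classDerivs (fun x => c * b x) m x i -
      classDerivs (fun x => c * b x) m y i) ^ 2) = c * ‖F x - F y‖ := by
    intro x y
    rw [← Real.norm_of_nonneg hc0.le, ← norm_smul, EuclideanSpace.norm_eq,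
      Real.norm_of_nonneg hc0.le]
    congr 1
    refine Finset.sum_congr rfl fun d _ => ?_
    rw [hcd, hcd, Real.norm_eq_abs, sq_abs]
    simp [mul_sub]
  refine ⟨fun x => c * b x, contDiff_const.mul hb, hbs.mul_left, fun x y => ?_, fun x y => ?_, ?_⟩
  · rw [hnorm]
    have := hC.norm_sub_le x y
    calc c * ‖F x - F y‖ ≤ c * (C * ‖x - y‖) := by gcongr
      _ = c * C * ‖x - y‖ := by ring
      _ ≤ 1 * ‖x - y‖ := by gcongr
      _ = _ := one_mul _
  · rw [hnorm]
    calc c * ‖F x - F y‖ ≤ c * (M + M) := by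
          gcongr
          exact (norm_sub_le _ _).trans (add_le_add (hM x) (hM y))
      _ ≤ 1 := by rwa [← two_mul]
  · have h0 : b (0 : Euc n) = 1 := b.one_of_mem_closedBall (by simp [b.rIn_pos.le])
    have hnorm : ‖(3 / 4 : ℝ) • stdVec (⟨0, hn⟩ : Fin n)‖ = 3 / 4 := by
      rw [norm_smul]
      simp
    have h1 : b ((3 / 4 : ℝ) • stdVec (⟨0, hn⟩ : Fin n)) = 0 := by
      refine b.zero_of_le_dist ?_
      rw [dist_zero_right, hnorm]
      norm_num [b]
    refine oscQuot_pos_of_ne (continuous_const.mul hb.continuous) (a := 0)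
      (b := (3 / 4 : ℝ) • stdVec (⟨0, hn⟩ : Fin n)) (by simp) ?_ ?_
    · rw [mem_ball_zero_iff, hnorm]
      norm_num
    · simpa only [Pi.mul_apply, h0, h1, mul_one, mul_zero] using hc0.ne'

/-- If `A` is not large at a single point `t`, a rescaled bump has unit seminorm but large mean
oscillation. -/
theorem exists_large_oscillation {n m : ℕ} (hn : 0 < n) {s : ℝ} (hsm : m < s) (hsm1 : s < m + 1) :
    ∃ κ I : ℝ, 0 < κ ∧ 0 < I ∧ ∀ A : ℝ → ℝ≥0∞, IsYoung A → ∀ t α : ℝ, 0 < t → 0 < α →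
      A t * ENNReal.ofReal I ≤ ENNReal.ofReal ((t / α) ^ (n / s)) →
      ∃ (u : Euc n → ℝ) (D : (h : ℕ) → Euc n → (Fin h → Fin n) → ℝ),
        HasWeakDerivs n m u D ∧ DecayFrom n 1 m D ∧ fracSem n (s - m) A (D m) ≤ 1 ∧
        oscQuot n (fun _ => 1) u 0 ((α / t) ^ s⁻¹) = α * κ := by
  obtain ⟨u₀, hu, hus, hlip, hbdd, hosc⟩ := exists_profile hn m
  set σ := s - m with hσ
  have hs : 0 < s := (Nat.cast_nonneg m).trans_lt hsm
  have hσ0 : 0 < σ := by linarith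
  have hσ1 : σ < 1 := by linarith
  set I₀ := ∫⁻ x : Euc n, ∫⁻ y : Euc n, ENNReal.ofReal (holderQuot σ (classDerivs u₀ m) x y) /
    ENNReal.ofReal (‖x - y‖ ^ (n : ℝ)) with hI₀
  have hI₀t : I₀ < ⊤ := lintegral_holderQuot_lt_top hn hσ0 hσ1
    (isClosed_tsupport (iteratedFDeriv ℝ m u₀)).measurableSet
    (hus.iteratedFDeriv (𝕜 := ℝ) m).isCompact.measure_lt_top.ne
    (fun x hx => by
      funext d
      simp [classDerivs, image_eq_zero_of_notMem_tsupport hx]) hlip hbdd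
  have hI : I₀ ≤ ENNReal.ofReal (I₀.toReal + 1) := by
    rw [ENNReal.le_ofReal_iff_toReal_le hI₀t.ne (by positivity)]
    linarith
  refine ⟨_, I₀.toReal + 1, hosc, by positivity, fun A hA t α ht hα hAt => ?_⟩
  set R := (α / t) ^ s⁻¹ with hR
  have hR0 : 0 < R := by positivity
  have hRs : R ^ s = α / t := by
    rw [hR, ← Real.rpow_mul (by positivity), inv_mul_cancel₀ hs.ne', Real.rpow_one]
  have hRn : (t / α) ^ (n / s) * R ^ n = 1 := by
    rw [← Real.rpow_natCast R n, hR, ← Real.rpow_mul (by positivity), inv_mul_eq_div,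
      ← Real.mul_rpow (by positivity) (by positivity), div_mul_div_cancel₀ hα.ne', div_self ht.ne',
      Real.one_rpow]
  have hAtop : A t ≠ ⊤ := by
    intro h
    rw [h, ENNReal.top_mul (ENNReal.ofReal_pos.2 (by positivity)).ne'] at hAt
    exact ENNReal.ofReal_ne_top (top_le_iff.1 hAt)
  set u : Euc n → ℝ := fun x => α * u₀ (R⁻¹ • x) with hu_def
  have hus' : HasCompactSupport u :=
    (hus.comp_smul (inv_ne_zero hR0.ne')).mul_left (f := fun _ => α)
  refine ⟨u, classDerivs u, hasWeakDerivs_classDerivs m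
    (contDiff_const.mul (hu.comp (contDiff_const_smul R⁻¹))) hus', decayFrom_classDerivs 1 m hus',
    ?_, oscQuot_comp_smul u₀ hR0 hα.le⟩
  refine sInf_le ⟨1, ⟨one_pos, ?_⟩, ENNReal.ofReal_one⟩
  simp only [div_one]
  refine (Jfun_le_of_comp_smul hA (v₀ := classDerivs u₀ m) (b := α * R⁻¹ ^ m) hR0 (by positivity)
    ht.le hAtop (fun x d => classDerivs_comp_smul hu α R⁻¹ x d) ?_ fun x y => ?_).trans ?_
  · have h1 : R ^ s = R ^ σ * R ^ m := by
      rw [← Real.rpow_natCast, ← Real.rpow_add hR0, hσ, sub_add_cancel]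
    have h2 : 0 < R ^ σ := by positivity
    have h3 : α = t * (R ^ σ * R ^ m) := by rw [← h1, hRs]; field_simp
    rw [Real.rpow_neg hR0.le, h3, inv_pow]
    field_simp
  · rcases eq_or_ne x y with rfl | hne
    · simp [holderQuot]
    have hN : 0 < ‖x - y‖ := norm_pos_iff.2 (sub_ne_zero.2 hne)
    rw [holderQuot, div_le_one (by positivity)]
    rcases le_total ‖x - y‖ 1 with h | h
    · refine (hlip x y).trans ?_
      simpa using Real.rpow_le_rpow_of_exponent_ge hN h hσ1.le
    · exact (hbdd x y).trans (Real.one_le_rpow h hσ0.le)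
  · calc _ ≤ A t * ENNReal.ofReal (R ^ n) * ENNReal.ofReal (I₀.toReal + 1) := by gcongr
      _ = A t * ENNReal.ofReal (I₀.toReal + 1) * ENNReal.ofReal (R ^ n) := by ring
      _ ≤ ENNReal.ofReal ((t / α) ^ (n / s)) * ENNReal.ofReal (R ^ n) := by gcongr
      _ = 1 := by
        rw [← ENNReal.ofReal_mul (by positivity), hRn, ENNReal.ofReal_one]

/-! ### Uniform embeddings into `BMO` and `VMO` -/

theorem ofReal_div_mul_rpow_le {a : ℝ≥0∞} {I t α q : ℝ} (hI : 0 < I) (ht : 0 < t) (hα : 0 < α)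
    (h : ENNReal.ofReal ((t / α) ^ q) ≤ a * ENNReal.ofReal I) :
    ENNReal.ofReal ((α ^ q * I)⁻¹ * t ^ q) ≤ a := by
  have h1 : (α ^ q * I)⁻¹ * t ^ q = (t / α) ^ q / I := by
    rw [Real.div_rpow ht.le hα.le]
    field_simp
  rw [h1, ENNReal.ofReal_div_of_pos hI]
  exact ENNReal.div_le_of_le_mul h

theorem exists_rpow_le_of_campSem_le {n m : ℕ} (hn : 0 < n) {s : ℝ} (hsm : m < s)
    (hsm1 : s < m + 1) {A : ℝ → ℝ≥0∞} (hA : IsYoung A) {c' : ℝ} (hc' : 0 < c')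
    (h : ∀ (u : Euc n → ℝ) (D : (h : ℕ) → Euc n → (Fin h → Fin n) → ℝ),
      HasWeakDerivs n m u D → DecayFrom n 1 m D → fracSem n (s - m) A (D m) < ⊤ →
      campSem n (fun _ => 1) u ≤ ENNReal.ofReal c' * fracSem n (s - m) A (D m)) :
    ∃ c : ℝ, 0 < c ∧ ∀ t : ℝ, 0 < t → ENNReal.ofReal (c * t ^ (n / s)) ≤ A t := by
  obtain ⟨κ, I, hκ, hI, H⟩ := exists_large_oscillation hn hsm hsm1
  have hα : 0 < 2 * c' / κ := by positivity
  refine ⟨((2 * c' / κ) ^ (n / s) * I)⁻¹, by positivity, fun t ht =>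
    ofReal_div_mul_rpow_le hI ht hα ?_⟩
  by_contra! hlt
  obtain ⟨u, D, hu, hD, hsem, hosc⟩ := H A hA t _ ht hα hlt.le
  have h1 : ENNReal.ofReal (2 * c' / κ * κ) ≤ campSem n (fun _ => 1) u := by
    rw [← hosc]
    exact le_iSup_of_le 0 (le_iSup₂_of_le _ (by positivity) le_rfl)
  have h2 := h1.trans (h u D hu hD (hsem.trans_lt ENNReal.one_lt_top))
  have h3 : ENNReal.ofReal (2 * c' / κ * κ) ≤ ENNReal.ofReal c' := by
    refine h2.trans ?_
    calc _ ≤ ENNReal.ofReal c' * 1 := by gcongr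
      _ = _ := mul_one _
  rw [div_mul_cancel₀ _ hκ.ne', ENNReal.ofReal_le_ofReal_iff hc'.le] at h3
  linarith

theorem exists_rpow_le_of_tendsto_campSemSmall {n m : ℕ} (hn : 0 < n) {s : ℝ} (hsm : m < s)
    (hsm1 : s < m + 1) {A : ℝ → ℝ≥0∞} (hA : IsYoung A)
    (h : Tendsto
      (fun r : ℝ =>
        ⨆ (u : Euc n → ℝ) (D : (h : ℕ) → Euc n → (Fin h → Fin n) → ℝ)
          (_ : HasWeakDerivs n m u D) (_ : DecayFrom n 1 m D)
          (_ : fracSem n (s - m) A (D m) ≤ 1), campSemSmall n (fun _ => 1) u r)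
      (𝓝[>] (0 : ℝ)) (𝓝 0)) {M : ℝ} (hM : 0 < M) :
    ∃ T : ℝ, 0 < T ∧ ∀ t : ℝ, T < t → ENNReal.ofReal (M * t ^ (n / s)) ≤ A t := by
  obtain ⟨κ, I, hκ, hI, H⟩ := exists_large_oscillation hn hsm hsm1
  have hs : 0 < s := (Nat.cast_nonneg m).trans_lt hsm
  have hn' : (0 : ℝ) < n := by exact_mod_cast hn
  set α : ℝ := (M * I)⁻¹ ^ (s / n) with hα
  have hα0 : 0 < α := by positivity
  have hαM : (α ^ (n / s) * I)⁻¹ = M := by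
    rw [hα, ← Real.rpow_mul (by positivity), div_mul_div_cancel₀ hn'.ne', div_self hs.ne',
      Real.rpow_one]
    field_simp
  have hpos : 0 < ENNReal.ofReal (α * κ) := ENNReal.ofReal_pos.2 (by positivity)
  obtain ⟨r, hr, hr0⟩ := ((h.eventually_lt_const hpos).and self_mem_nhdsWithin).exists
  have hr0 : 0 < r := hr0
  have hlim : Tendsto (fun t : ℝ => ENNReal.ofReal (((α / t) ^ s⁻¹) ^ n) *
      volume (ball (0 : Euc n) 1)) atTop (𝓝 0) := by
    have h1 : Tendsto (fun t : ℝ => ((α / t) ^ s⁻¹) ^ n) atTop (𝓝 0) := by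
      have h2 : Tendsto (fun t : ℝ => α / t) atTop (𝓝 0) := tendsto_const_nhds.div_atTop tendsto_id
      have h3 := (h2.rpow_const (p := s⁻¹) (Or.inr (by positivity))).pow n
      rwa [Real.zero_rpow (by positivity), zero_pow hn.ne'] at h3
    have h4 := ENNReal.Tendsto.mul_const (ENNReal.tendsto_ofReal h1)
      (b := volume (ball (0 : Euc n) 1)) (Or.inr measure_ball_lt_top.ne)
    simpa using h4
  obtain ⟨T, hT⟩ := eventually_atTop.1
    (hlim.eventually_le_const (ENNReal.ofReal_pos.2 hr0))
  refine ⟨max T 1, by positivity, fun t ht => ?_⟩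
  have ht0 : 0 < t := lt_trans (by positivity) ht
  rw [← hαM]
  refine ofReal_div_mul_rpow_le hI ht0 hα0 ?_
  by_contra! hlt
  obtain ⟨u, D, hu, hD, hsem, hosc⟩ := H A hA t α ht0 hα0 hlt.le
  refine absurd hr (not_lt.2 ?_)
  refine le_iSup₂_of_le u D (le_iSup₂_of_le hu hD (le_iSup_of_le hsem ?_))
  rw [← hosc]
  refine le_iSup_of_le 0 (le_iSup₂_of_le ((α / t) ^ s⁻¹) (by positivity) (le_iSup_of_le ?_ le_rfl))
  rw [volume_ball_eq _ (by positivity)]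
  exact hT t ((le_max_left _ _).trans ht.le)

theorem IsYoung.one_le_of_rpow_le {A : ℝ → ℝ≥0∞} (hA : IsYoung A) {c q : ℝ} (hc : 0 < c)
    (h : ∀ t : ℝ, 0 < t → ENNReal.ofReal (c * t ^ q) ≤ A t) : 1 ≤ q := by
  by_contra! hq
  obtain ⟨t, ht, hAt⟩ := hA.exists_pos_ne_top
  have h1 : ∀ w : ℝ, 0 < w → w ≤ 1 → c * t ^ q ≤ w ^ (1 - q) * (A t).toReal := by
    intro w hw hw1
    have h2 := (h (w * t) (by positivity)).trans (hA.apply_mul_le hw.le hw1 ht.le)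
    rw [← ENNReal.ofReal_toReal hAt, ← ENNReal.ofReal_mul hw.le,
      ENNReal.ofReal_le_ofReal_iff (by positivity), Real.mul_rpow hw.le ht.le] at h2
    rw [Real.rpow_sub hw, Real.rpow_one, div_mul_eq_mul_div, le_div_iff₀ (by positivity)]
    linarith
  have h2 : Tendsto (fun w : ℝ => w ^ (1 - q) * (A t).toReal) (𝓝[>] 0) (𝓝 0) := by
    have h3 : Tendsto (fun w : ℝ => w ^ (1 - q)) (𝓝 0) (𝓝 (0 ^ (1 - q))) :=
      tendsto_id.rpow_const (Or.inr (by linarith))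
    rw [Real.zero_rpow (by linarith)] at h3
    simpa using (h3.mono_left nhdsWithin_le_nhds).mul_const (A t).toReal
  have h3 : c * t ^ q ≤ 0 := by
    refine ge_of_tendsto h2 ?_
    filter_upwards [Ioc_mem_nhdsGT one_pos] with w hw using h1 w hw.1 hw.2
  have : 0 < c * t ^ q := by positivity
  linarith

theorem exists_campSem_le_of_conjBound {n m : ℕ} (hn : 0 < n) {s : ℝ} (hsm : m < s)
    (hsm1 : s < m + 1) {A : ℝ → ℝ≥0∞} {a : ℝ} (ha : 0 ≤ a) (hA : ConjBound A n s 1 a 0) :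
    ∃ c' : ℝ, 0 < c' ∧ ∀ (u : Euc n → ℝ) (D : (h : ℕ) → Euc n → (Fin h → Fin n) → ℝ),
      HasWeakDerivs n m u D → DecayFrom n 1 m D →
      campSem n (fun _ => 1) u ≤ ENNReal.ofReal c' * fracSem n (s - m) A (D m) := by
  obtain ⟨C, hC, H⟩ := exists_ofReal_oscQuot_le hn hsm hsm1 A
  have hc : 0 < C * (1 + a) := by positivity
  refine ⟨C * (1 + a), hc, fun u D hu hD => ?_⟩
  have hc0 : ENNReal.ofReal (C * (1 + a)) ≠ 0 := (ENNReal.ofReal_pos.2 hc).ne'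
  refine (ENNReal.div_le_iff_le_mul (Or.inl hc0) (Or.inl ENNReal.ofReal_ne_top)).1
    (le_sInf ?_) |>.trans_eq (mul_comm _ _)
  rintro _ ⟨lam, ⟨hlam, hJ⟩, rfl⟩
  refine ENNReal.div_le_of_le_mul ?_
  refine iSup_le fun x => iSup₂_le fun r hr => ?_
  refine (H u D hu hD lam 1 a 0 hlam one_pos ha le_rfl hJ hA x r hr).trans_eq ?_
  rw [← ENNReal.ofReal_mul hlam.le]
  congr 1
  ring

theorem tendsto_campSemSmall_of_conjBound {n m : ℕ} (hn : 0 < n) {s : ℝ} (hsm : m < s)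
    (hsm1 : s < m + 1) {A : ℝ → ℝ≥0∞}
    (hA : ∀ δ, 0 < δ → ∃ b, 0 ≤ b ∧ ConjBound A n s δ 1 b) :
    Tendsto
      (fun r : ℝ =>
        ⨆ (u : Euc n → ℝ) (D : (h : ℕ) → Euc n → (Fin h → Fin n) → ℝ)
          (_ : HasWeakDerivs n m u D) (_ : DecayFrom n 1 m D)
          (_ : fracSem n (s - m) A (D m) ≤ 1), campSemSmall n (fun _ => 1) u r)
      (𝓝[>] (0 : ℝ)) (𝓝 0) := by
  obtain ⟨C, hC, H⟩ := exists_ofReal_oscQuot_le hn hsm hsm1 A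
  obtain ⟨hV0, hVt⟩ := volume_ball_pos_ne (0 : Euc n) one_pos
  refine ENNReal.tendsto_nhds_zero.2 fun ε hε => ?_
  obtain ⟨η, hη, hηε⟩ : ∃ η : ℝ, 0 < η ∧ ENNReal.ofReal η ≤ ε := by
    rcases eq_or_ne ε ⊤ with rfl | hεt
    · exact ⟨1, one_pos, le_top⟩
    · exact ⟨ε.toReal, ENNReal.toReal_pos hε.ne' hεt, ENNReal.ofReal_toReal_le⟩
  obtain ⟨b, hb, hAb⟩ := hA (η / (6 * C)) (by positivity)
  set V := (volume (ball (0 : Euc n) 1)).toReal with hV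
  have hVpos : 0 < V := ENNReal.toReal_pos hV0 hVt
  set R : ℝ := ((b + 1)⁻¹) ^ 2 with hR
  have hR0 : 0 < R := by positivity
  filter_upwards [Ioc_mem_nhdsGT (show 0 < R ^ n * V by positivity)] with r hr
  refine iSup₂_le fun u D => iSup₂_le fun hu hD => iSup_le fun hsem => ?_
  refine iSup_le fun x => iSup₂_le fun ρ hρ => iSup_le fun hvol => ?_
  obtain ⟨_, ⟨lam, ⟨hlam, hJ⟩, rfl⟩, hlam2⟩ := sInf_lt_iff.1
    (hsem.trans_lt (show (1 : ℝ≥0∞) < ENNReal.ofReal 2 by simp))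
  have hlam2 : lam ≤ 2 := ((ENNReal.ofReal_lt_ofReal_iff two_pos).1 hlam2).le
  have hρR : ρ ≤ R := by
    rw [volume_ball_eq x hρ, ← ENNReal.ofReal_toReal hVt, ← ENNReal.ofReal_mul (by positivity),
      ENNReal.ofReal_le_ofReal_iff hr.1.le] at hvol
    exact le_of_pow_le_pow_left₀ hn.ne' hR0.le (le_of_mul_le_mul_right (hvol.trans hr.2) hVpos)
  have hbρ : b * √ρ ≤ 1 := by
    have h1 : √ρ ≤ (b + 1)⁻¹ := by
      rw [← Real.sqrt_sq (show 0 ≤ (b + 1)⁻¹ by positivity)]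
      exact Real.sqrt_le_sqrt hρR
    calc b * √ρ ≤ (b + 1) * (b + 1)⁻¹ := by gcongr; linarith
      _ = 1 := mul_inv_cancel₀ (by positivity)
  refine (H u D hu hD lam _ 1 b hlam (by positivity) zero_le_one hb hJ hAb x ρ hρ).trans
    (le_trans (ENNReal.ofReal_le_ofReal ?_) hηε)
  calc C * (lam * (η / (6 * C)) * (1 + 1 + b * √ρ))
      ≤ C * (2 * (η / (6 * C)) * (1 + 1 + 1)) := by gcongr
    _ = η := by
      field_simp
      norm_num

/-- `V^{s,A}_{d,1}(ℝⁿ) → VMO(ℝⁿ)` uniformly if and only if either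
`s < n`, `∫_0^t Ã(τ) τ^{-1-n/(n+1-s)} dτ ≤ c t^{n/((n-s)(n+1-s))}` for all `t > 0` and
`t^{-n/((n-s)(n+1-s))} ∫_0^t Ã(τ) τ^{-1-n/(n+1-s)} dτ → 0` as `t → ∞`, or `s = n` and
`A(t) ≥ c t` near zero. -/
theorem stmt10 (n : ℕ) (hn : 0 < n) (s : ℝ) (hs : s ∈ Set.Ioo (1 : ℝ) ((n : ℝ) + 1))
    (hs2 : ∀ m : ℕ, s ≠ (m : ℝ)) (A : ℝ → ℝ≥0∞) (hA : IsYoung A) :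
    ((∃ c' : ℝ, 0 < c' ∧
        ∀ (u : Euc n → ℝ) (D : (h : ℕ) → Euc n → (Fin h → Fin n) → ℝ),
          HasWeakDerivs n ⌊s⌋₊ u D → DecayFrom n 1 ⌊s⌋₊ D →
          fracSem n (s - (⌊s⌋₊ : ℝ)) A (D ⌊s⌋₊) < ⊤ →
          campSem n (fun _ => 1) u ≤
            ENNReal.ofReal c' * fracSem n (s - (⌊s⌋₊ : ℝ)) A (D ⌊s⌋₊)) ∧
      Tendsto
        (fun r : ℝ =>
          ⨆ (u : Euc n → ℝ) (D : (h : ℕ) → Euc n → (Fin h → Fin n) → ℝ)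
            (_ : HasWeakDerivs n ⌊s⌋₊ u D) (_ : DecayFrom n 1 ⌊s⌋₊ D)
            (_ : fracSem n (s - (⌊s⌋₊ : ℝ)) A (D ⌊s⌋₊) ≤ 1),
            campSemSmall n (fun _ => 1) u r)
        (𝓝[>] (0 : ℝ)) (𝓝 0)) ↔
    ((s < (n : ℝ) ∧
        (∃ c : ℝ, 0 < c ∧ ∀ t : ℝ, 0 < t →
          (∫⁻ τ in Set.Ioc (0 : ℝ) t,
              youngConj A τ * ENNReal.ofReal (τ ^ (-1 - (n : ℝ) / ((n : ℝ) + 1 - s)))) ≤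
            ENNReal.ofReal (c * t ^ ((n : ℝ) / (((n : ℝ) - s) * ((n : ℝ) + 1 - s))))) ∧
        Tendsto
          (fun t : ℝ =>
            ENNReal.ofReal (t ^ (-(n : ℝ) / (((n : ℝ) - s) * ((n : ℝ) + 1 - s)))) *
              ∫⁻ τ in Set.Ioc (0 : ℝ) t,
                youngConj A τ * ENNReal.ofReal (τ ^ (-1 - (n : ℝ) / ((n : ℝ) + 1 - s))))
          atTop (𝓝 0)) ∨
      (s = (n : ℝ) ∧ ∃ c t₀ : ℝ, 0 < c ∧ 0 < t₀ ∧
        ∀ t ∈ Set.Icc (0 : ℝ) t₀, ENNReal.ofReal (c * t) ≤ A t)) := by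
  obtain ⟨hs1, hsn1⟩ := hs
  have hs0 : 0 < s := one_pos.trans hs1
  have hn' : (0 : ℝ) < n := by exact_mod_cast hn
  set m := ⌊s⌋₊ with hm
  have hsm : (m : ℝ) < s := lt_of_le_of_ne (Nat.floor_le hs0.le) (hs2 m).symm
  have hsm1 : s < m + 1 := Nat.lt_floor_add_one s
  have hp : 0 < (n : ℝ) / ((n : ℝ) + 1 - s) := div_pos hn' (by linarith)
  have hexp (hsn : s < n) : (n : ℝ) / (n - s) - n / ((n : ℝ) + 1 - s) =
      (n : ℝ) / (((n : ℝ) - s) * ((n : ℝ) + 1 - s)) := by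
    have h1 : (n : ℝ) - s ≠ 0 := by linarith
    have h2 : (n : ℝ) + 1 - s ≠ 0 := by linarith
    field_simp
    ring
  constructor
  · rintro ⟨⟨c', hc', hB⟩, hV⟩
    obtain ⟨c, hc, hAc⟩ := exists_rpow_le_of_campSem_le hn hsm hsm1 hA hc' hB
    have hsn : s < n := by
      have h1 := hA.one_le_of_rpow_le hc hAc
      rw [one_le_div hs0] at h1
      exact lt_of_le_of_ne h1 (hs2 n)
    have hns : 0 < (n : ℝ) - s := by linarith
    have hq : 1 < (n : ℝ) / s := (one_lt_div hs0).2 hsn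
    have hqq : (n : ℝ) / s / (n / s - 1) = n / (n - s) := by
      rw [div_sub_one hs0.ne', div_div_div_cancel_right₀ hs0.ne']
    have hpq : (n : ℝ) / ((n : ℝ) + 1 - s) < n / s / (n / s - 1) := by
      rw [hqq]
      exact div_lt_div_of_pos_left hn' hns (by linarith)
    obtain ⟨h1, h2⟩ := conjInt_bounds_of_rpow_le hq hpq hc hAc fun M hM =>
      exists_rpow_le_of_tendsto_campSemSmall hn hsm hsm1 hA hV hM
    rw [hqq, hexp hsn] at h1 h2
    rw [← neg_div] at h2
    exact Or.inl ⟨hsn, h1, h2⟩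
  · rintro (⟨hsn, ⟨c, hc, hcA⟩, hlim⟩ | ⟨h, -⟩)
    · rw [neg_div, ← hexp hsn] at hlim
      rw [← hexp hsn] at hcA
      obtain ⟨C, hC, -, hCb⟩ := conjBound_of_conjInt hsn hp hc hcA
      have h1 := hCb 1 one_pos
      obtain ⟨c', hc', hB⟩ := exists_campSem_le_of_conjBound hn hsm hsm1 (by positivity) h1
      exact ⟨⟨c', hc', fun u D hu hD _ => hB u D hu hD⟩,
        tendsto_campSemSmall_of_conjBound hn hsm hsm1 fun δ hδ =>
          conjBound_one_of_tendsto hsn hp hc hcA hlim hδ⟩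
    · exact absurd h (hs2 n)
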